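/- arXiv:1901.09539 — 2 statements merged into one kernel-verified Lean document; each statement's English description precedes it below -/
import Mathlib

section
/- Let H ∈ C^∞(ℝ²) be convex, let U ⊆ ℝ² be a domain, and let v ∈ C^∞(U). Then at every point of U one has the pointwise identity ⟨D²H(Dv)·D[H(Dv)], D[H(Dv)]⟩ − div(D_pH(Dv))·𝒜_H[v] = (−det D²v)·⟨(D²H(Dv))*·D_pH(Dv), D_pH(Dv)⟩, where D[H(Dv)] is the gradient of x ↦ H(Dv(x)) and A* is the adjugate of the 2×2 matrix A. -/
open MeasureTheory Set Filter Topology Metric Bornology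
open scoped Classical ENNReal NNReal

noncomputable section

/-- The Euclidean plane `ℝ²`. -/
abbrev E2 := EuclideanSpace ℝ (Fin 2)

/-- `i`-th standard coordinate vector of `ℝ²`. -/
def e2 (i : Fin 2) : E2 := EuclideanSpace.single i 1

/-- The partial derivative `∂f/∂xᵢ` (via the total Fréchet derivative; junk value `0`
where `f` is not differentiable). -/
def pd (f : E2 → ℝ) (i : Fin 2) (x : E2) : ℝ := fderiv ℝ f x (e2 i)

/-- The gradient of `f` as a vector in `Fin 2 → ℝ`. -/
def gradV (f : E2 → ℝ) (x : E2) : Fin 2 → ℝ := fun i => pd f i x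

/-- The gradient of `f` as an element of `ℝ²`. -/
def gradE (f : E2 → ℝ) (x : E2) : E2 := (EuclideanSpace.equiv (Fin 2) ℝ).symm (gradV f x)

/-- Second partial derivative `∂ᵢ∂ⱼ f`. -/
def pd2 (f : E2 → ℝ) (i j : Fin 2) (x : E2) : ℝ := pd (fun y => pd f j y) i x

/-- Hessian matrix of `f` at `x`. -/
def hessM (f : E2 → ℝ) (x : E2) : Matrix (Fin 2) (Fin 2) ℝ := Matrix.of fun i j => pd2 f i j x

/-- Operator norm of the second derivative of `f` at `x`. -/
def hessNorm (f : E2 → ℝ) (x : E2) : ℝ := ‖fderiv ℝ (fderiv ℝ f) x‖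

/-- Euclidean norm of a vector in `Fin 2 → ℝ`. -/
def vnorm (a : Fin 2 → ℝ) : ℝ := Real.sqrt (∑ i, a i ^ 2)

/-- The Aronsson operator `𝒜_H[v] = Σ_{i,j} H_{p_i}(Dv) H_{p_j}(Dv) v_{x_i x_j}`. -/
def aronsson (H v : E2 → ℝ) (x : E2) : ℝ :=
  ∑ i, ∑ j, pd H i (gradE v x) * pd H j (gradE v x) * pd2 v i j x

/-- `div (D_pH(Dv))`. -/
def divDpH (H v : E2 → ℝ) (x : E2) : ℝ := ∑ i, pd (fun y => pd H i (gradE v y)) i x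

/-- The `L^∞` norm (essential supremum) of `f` on `V`. -/
def supNorm (f : E2 → ℝ) (V : Set E2) : ℝ := (eLpNorm f ⊤ (volume.restrict V)).toReal

/-- The supremum norm of `f` on `K`. -/
def supAbs (K : Set E2) (f : E2 → ℝ) : ℝ := sSup ((fun x => |f x|) '' K)

/-- The `L^q` norm of `f` on `V`. -/
def lpNorm (q : ℝ) (V : Set E2) (f : E2 → ℝ) : ℝ := (∫ x in V, |f x| ^ q) ^ (1 / q)

/-- The integral average `⨍_V f`. -/
def avgOn (V : Set E2) (f : E2 → ℝ) : ℝ := (volume V).toReal⁻¹ * ∫ x in V, f x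

/-- Distance between two sets. -/
def setDist (s t : Set E2) : ℝ := sInf {d : ℝ | ∃ x ∈ s, ∃ y ∈ t, d = dist x y}

/-- `f` is locally Lipschitz on `O`. -/
def LocLipOn (O : Set E2) (f : E2 → ℝ) : Prop :=
  ∀ x ∈ O, ∃ K : ℝ≥0, ∃ t ∈ 𝓝[O] x, LipschitzOnWith K f t

/-- `u` is an absolute minimizer for the Hamiltonian `H` in `Ω`. -/
def IsAbsMin (H : E2 → ℝ) (Ω : Set E2) (u : E2 → ℝ) : Prop :=
  LocLipOn Ω u ∧
  ∀ V : Set E2, IsOpen V → IsBounded V → closure V ⊆ Ω →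
    ∀ v : E2 → ℝ, LocLipOn V v → ContinuousOn v (closure V) →
      (∀ x ∈ frontier V, v x = u x) →
      supNorm (fun x => H (gradE u x)) V ≤ supNorm (fun x => H (gradE v x)) V

/-- The hypotheses (H1')&(H2): `H(0) = 0 = min H`, and `H` is globally strongly
convex and strongly concave. -/
def StrongH (H : E2 → ℝ) : Prop :=
  H 0 = 0 ∧ (∀ p, 0 ≤ H p) ∧
  ∃ lam Lam : ℝ, 0 < lam ∧ lam ≤ Lam ∧
    ConvexOn ℝ univ (fun p => H p - lam / 2 * ‖p‖ ^ 2) ∧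
    ConvexOn ℝ univ (fun p => Lam / 2 * ‖p‖ ^ 2 - H p)

/-- The hypotheses (H1)&(H2): `H(0) = 0 = min H`, and `H` is locally strongly
convex and locally strongly concave. -/
def LocStrongH (H : E2 → ℝ) : Prop :=
  H 0 = 0 ∧ (∀ p, 0 ≤ H p) ∧
  ∀ K : Set E2, Convex ℝ K → IsBounded K →
    ∃ lam Lam : ℝ, 0 < lam ∧ 0 < Lam ∧
      ConvexOn ℝ K (fun p => H p - lam / 2 * ‖p‖ ^ 2) ∧
      ConvexOn ℝ K (fun p => Lam / 2 * ‖p‖ ^ 2 - H p)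

/-- `λ_H(∞)`: the supremum of admissible global strong convexity constants. -/
def lamInf (H : E2 → ℝ) : ℝ :=
  sSup {l : ℝ | 0 < l ∧ ConvexOn ℝ univ (fun p => H p - l / 2 * ‖p‖ ^ 2)}

/-- `Λ_H(∞)`: the infimum of admissible global strong concavity constants. -/
def LamInf (H : E2 → ℝ) : ℝ :=
  sInf {L : ℝ | 0 < L ∧ ConvexOn ℝ univ (fun p => L / 2 * ‖p‖ ^ 2 - H p)}

/-- `λ_H(R)`. -/
def lamR (H : E2 → ℝ) (R : ℝ) : ℝ :=
  ⨆ ε : {t : ℝ // 0 < t},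
    sInf {l : ℝ | 0 < l ∧ ConvexOn ℝ (H ⁻¹' Ico 0 (R + ε.1)) (fun p => H p - l / 2 * ‖p‖ ^ 2)}

/-- `Λ_H(R)`. -/
def LamR (H : E2 → ℝ) (R : ℝ) : ℝ :=
  ⨅ ε : {t : ℝ // 0 < t},
    sSup {L : ℝ | 0 < L ∧ ConvexOn ℝ (H ⁻¹' Ico 0 (R + ε.1)) (fun p => L / 2 * ‖p‖ ^ 2 - H p)}

/-- `τ̃_H(p)`. -/
def tauTilde (H : E2 → ℝ) (p : E2) : ℝ :=
  if p = 0 then 1 / 2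
  else H p / ∑ i, (hessM H p)⁻¹.mulVec (gradV H p) i * gradV H p i

/-- `τ_H(R)` for twice differentiable `H`. -/
def tauR (H : E2 → ℝ) (R : ℝ) : ℝ := sInf {t : ℝ | ∃ p : E2, H p ≤ R ∧ t = tauTilde H p}

/-- `τ_H(∞) = lim_{R → ∞} τ_H(R)`. -/
def tauInf (H : E2 → ℝ) : ℝ := ⨅ R : {r : ℝ // 0 ≤ r}, tauR H R.1

/-- A standard mollifier supported in the ball of radius `δ`. -/
def stdMollifier (δ : ℝ) : E2 → ℝ :=
  if h : 0 < δ then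
    (⟨δ / 2, δ, by linarith, by linarith⟩ : ContDiffBump (0 : E2)).normed volume
  else 0

/-- Mollification `η_δ * H`. -/
def mollified (H : E2 → ℝ) (δ : ℝ) (p : E2) : ℝ := ∫ q, stdMollifier δ q * H (p - q)

/-- The unique minimum point `p^δ` of `η_δ * H` (junk value `0` if it does not exist). -/
def minPt (H : E2 → ℝ) (δ : ℝ) : E2 :=
  if h : ∃ p : E2, (∀ q, mollified H δ p ≤ mollified H δ q) ∧
      ∀ p' : E2, (∀ q, mollified H δ p' ≤ mollified H δ q) → p' = p
  then h.choose else 0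

/-- The standard smooth approximation `H^δ(p) = (η_δ*H)(p + p^δ) − (η_δ*H)(p^δ)`. -/
def smoothApprox (H : E2 → ℝ) (δ : ℝ) (p : E2) : ℝ :=
  mollified H δ (p + minPt H δ) - mollified H δ (minPt H δ)

/-- `τ_H(R) = sup_{ε>0} limsup_{δ→0} τ_{H^δ}(R+ε)` for merely continuous `H`. -/
def tauC0 (H : E2 → ℝ) (R : ℝ) : ℝ :=
  ⨆ ε : {t : ℝ // 0 < t},
    Filter.limsup (fun δ => tauR (smoothApprox H δ) (R + ε.1)) (𝓝[>] (0 : ℝ))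

/-- `φ` is a smooth test function with compact support contained in `O`. -/
def IsTestOn (O : Set E2) (φ : E2 → ℝ) : Prop :=
  ContDiff ℝ (⊤ : ℕ∞) φ ∧ HasCompactSupport φ ∧ tsupport φ ⊆ O

/-- `g` is the weak gradient of `f` on `O`. -/
def HasWeakGradOn (O : Set E2) (f : E2 → ℝ) (g : E2 → Fin 2 → ℝ) : Prop :=
  ∀ φ : E2 → ℝ, IsTestOn O φ →
    ∀ i : Fin 2, ∫ x in O, f x * pd φ i x = - ∫ x in O, g x i * φ x

/-- `f ∈ L²_loc(O)`. -/
def MemL2loc (O : Set E2) (f : E2 → ℝ) : Prop :=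
  ∀ V : Set E2, IsOpen V → IsBounded V → closure V ⊆ O →
    IntegrableOn (fun x => f x ^ 2) V volume

/-- `f ∈ W^{1,2}_loc(O)`. -/
def MemW12loc (O : Set E2) (f : E2 → ℝ) : Prop :=
  MemL2loc O f ∧ ∃ g : E2 → Fin 2 → ℝ, HasWeakGradOn O f g ∧
    ∀ i, MemL2loc O (fun x => g x i)

/-- Convergence `f_s → f` in `L^t_loc(O)` for all `t ∈ [1,∞)`, as `s → 0⁺`. -/
def LtLocConv (O : Set E2) (fι : ℝ → E2 → ℝ) (f : E2 → ℝ) : Prop :=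
  ∀ t : ℝ, 1 ≤ t → ∀ V : Set E2, IsOpen V → IsBounded V → closure V ⊆ O →
    Tendsto (fun s => ∫ x in V, |fι s x - f x| ^ t) (𝓝[>] (0 : ℝ)) (𝓝 0)

/-- Weak convergence `f_s → f` in `W^{1,2}_loc(O)` as `s → 0⁺`. -/
def WeakW12locConv (O : Set E2) (fι : ℝ → E2 → ℝ) (f : E2 → ℝ) : Prop :=
  ∃ g : E2 → Fin 2 → ℝ, HasWeakGradOn O f g ∧
  ∃ gι : ℝ → E2 → Fin 2 → ℝ, (∀ s, HasWeakGradOn O (fι s) (gι s)) ∧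
    ∀ V : Set E2, IsOpen V → IsBounded V → closure V ⊆ O →
      Tendsto (fun s => ∫ x in V, (fι s x - f x) ^ 2) (𝓝[>] (0 : ℝ)) (𝓝 0) ∧
      ∀ h : E2 → Fin 2 → ℝ, IntegrableOn (fun x => ∑ i, h x i ^ 2) V volume →
        Tendsto (fun s => ∫ x in V, ∑ i, gι s x i * h x i) (𝓝[>] (0 : ℝ))
          (𝓝 (∫ x in V, ∑ i, g x i * h x i))

/-- `w` solves the Dirichlet problem `div(e^{H(Dw)/ε} D_pH(Dw)) = 0` in `U`, `w = u` on `∂U`. -/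
def ExpSol (H : E2 → ℝ) (U : Set E2) (u : E2 → ℝ) (ε : ℝ) (w : E2 → ℝ) : Prop :=
  ContDiffOn ℝ (⊤ : ℕ∞) w U ∧ ContinuousOn w (closure U) ∧
  (∀ x ∈ U, ∑ i, pd (fun y => Real.exp (H (gradE w y) / ε) * pd H i (gradE w y)) i x = 0) ∧
  ∀ x ∈ frontier U, w x = u x

/-- `U` has a smooth boundary. -/
def SmoothBoundary (U : Set E2) : Prop :=
  ∀ x ∈ frontier U, ∃ V : Set E2, ∃ φ : E2 → ℝ, IsOpen V ∧ x ∈ V ∧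
    ContDiff ℝ (⊤ : ℕ∞) φ ∧ (∀ y ∈ V, fderiv ℝ φ y ≠ 0) ∧ U ∩ V = {y ∈ V | φ y < 0}

/-- The `C^{0,γ}` norm of `f` on `K`. -/
def holderNorm (γ : ℝ) (K : Set E2) (f : E2 → ℝ) : ℝ :=
  supAbs K f + sSup {c : ℝ | ∃ x ∈ K, ∃ y ∈ K, x ≠ y ∧ c = |f x - f y| / dist x y ^ γ}

/-- The normalized density `σ^ε` of `e^{H(Dw)/ε}` over `U`. -/
def sigmaEps (H : E2 → ℝ) (U : Set E2) (w : E2 → ℝ) (ε : ℝ) (x : E2) : ℝ :=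
  Real.exp (H (gradE w x) / ε) / ∫ y in U, Real.exp (H (gradE w y) / ε)

/-- The affine function `x ↦ c + ⟨b, x⟩`. -/
def affF (c : ℝ) (b : Fin 2 → ℝ) (x : E2) : ℝ :=
  c + ∑ i, b i * (EuclideanSpace.equiv (Fin 2) ℝ) x i


theorem fderiv_eq_sum_pd (f : E2 → ℝ) (p w : E2) :
    fderiv ℝ f p w = ∑ j, pd f j p * w j := by
  have hw : w = ∑ j, w j • e2 j := by
    ext k
    fin_cases k <;> simp [Fin.sum_univ_two, e2]
  conv_lhs => rw [hw]
  simp [pd, mul_comm]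

/-- Each partial derivative of a `C²` function is differentiable. -/
theorem ContDiffAt.differentiableAt_pd {f : E2 → ℝ} {x : E2} (hf : ContDiffAt ℝ 2 f x)
    (j : Fin 2) : DifferentiableAt ℝ (fun y => pd f j y) x :=
  ((hf.fderiv_right (m := 1) (by norm_num)).differentiableAt (by norm_num)).clm_apply
    (differentiableAt_const _)

theorem ContDiffAt.pd2_comm {f : E2 → ℝ} {x : E2} (hf : ContDiffAt ℝ 2 f x) (i j : Fin 2) :
    pd2 f i j x = pd2 f j i x := by
  have hd : DifferentiableAt ℝ (fderiv ℝ f) x :=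
    (hf.fderiv_right (m := 1) (by norm_num)).differentiableAt (by norm_num)
  have key (a b : Fin 2) : pd2 f a b x = fderiv ℝ (fderiv ℝ f) x (e2 a) (e2 b) := by
    unfold pd2 pd
    rw [fderiv_clm_apply hd (differentiableAt_const _)]
    simp
  rw [key, key]
  exact hf.isSymmSndFDerivAt (by simp) _ _

/-- The chain rule for the composition of a function with a gradient. -/
theorem pd_comp_gradE {F v : E2 → ℝ} {x : E2} (hF : DifferentiableAt ℝ F (gradE v x))
    (hv : ContDiffAt ℝ 2 v x) (i : Fin 2) :
    pd (fun y => F (gradE v y)) i x = ∑ j, pd F j (gradE v x) * pd2 v i j x := by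
  have hg : DifferentiableAt ℝ (gradE v) x :=
    differentiableAt_euclidean.2 fun j => hv.differentiableAt_pd j
  have hcoord (j : Fin 2) : fderiv ℝ (gradE v) x (e2 i) j = pd2 v i j x := by
    have h := ((EuclideanSpace.proj (𝕜 := ℝ) j).hasFDerivAt.comp x hg.hasFDerivAt).fderiv
    exact (congrArg (fun L : E2 →L[ℝ] ℝ => L (e2 i)) h).symm
  change fderiv ℝ (F ∘ gradE v) x (e2 i) = _
  rw [fderiv_comp x hF hg, ContinuousLinearMap.comp_apply, fderiv_eq_sum_pd]
  simp only [hcoord]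

/-- structural identity for the Aronsson operator, Lemma 2.1. -/
theorem statement0
    (H : E2 → ℝ) (hH : ContDiff ℝ (⊤ : ℕ∞) H) (hHconv : ConvexOn ℝ univ H)
    (U : Set E2) (hUopen : IsOpen U) (hUconn : IsConnected U)
    (v : E2 → ℝ) (hv : ContDiffOn ℝ (⊤ : ℕ∞) v U) :
    ∀ x ∈ U,
      (∑ i, (hessM H (gradE v x)).mulVec (gradV (fun y => H (gradE v y)) x) i *
          gradV (fun y => H (gradE v y)) x i)
        - divDpH H v x * aronsson H v x
      = (-(hessM v x).det) *
          ∑ i, (hessM H (gradE v x)).adjugate.mulVec (gradV H (gradE v x)) i *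
            gradV H (gradE v x) i := by
  intro x hx
  have hv2 : ContDiffAt ℝ 2 v x :=
    (hv.contDiffAt (hUopen.mem_nhds hx)).of_le (WithTop.coe_le_coe.2 (le_top (a := (2 : ℕ∞))))
  have hH2 : ContDiffAt ℝ 2 H (gradE v x) := hH.contDiffAt.of_le (WithTop.coe_le_coe.2 (le_top (a := (2 : ℕ∞))))
  have hgrad (i : Fin 2) := pd_comp_gradE (hH2.differentiableAt (by norm_num)) hv2 i
  have hdiv (i : Fin 2) := pd_comp_gradE (hH2.differentiableAt_pd i) hv2 i
  have hpd2 (i j : Fin 2) : pd (fun y => pd H j y) i (gradE v x) = pd2 H i j (gradE v x) := rfl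
  simp only [divDpH, aronsson, gradV, hgrad, hdiv, hpd2, hessM, Matrix.mulVec, dotProduct,
    Matrix.adjugate_fin_two, Matrix.det_fin_two, Fin.sum_univ_two, Matrix.of_apply,
    Matrix.cons_val_zero, Matrix.cons_val_one, hv2.pd2_comm 1 0, hH2.pd2_comm 1 0]
  ring

end
end

section
/- Suppose H ∈ C^∞(ℝ²) satisfies (H1')&(H2). Let U ⊆ ℝ² be a domain, ε ∈ (0,1], and let u^ε ∈ C^∞(U) satisfy 𝒜_H[u^ε] + ε·div(D_pH(Du^ε)) = 0 in U. There is an absolute constant C such that for every ball B = B(x̄,r) with B ⋐ U and every affine function F on ℝ²: ⨍_{(1/2)B} ⟨D_pH(Du^ε), Du^ε − DF⟩² dx ≤ C Λ_H(∞) (∫_{(3/4)B} |D[H(Du^ε)]|² dx)^{1/2} (⨍_B ((|Du^ε|+|DF|)²(u^ε−F)²/r² + (u^ε−F)⁴/r⁴) dx)^{1/2} + C (Λ_H(∞)²/λ_H(∞)) (⨍_{(3/4)B} [H(Du^ε)]² dx)^{1/2} (⨍_{(3/4)B} (u^ε−F)⁴/r⁴ dx)^{1/2} + C ε (∫_{(3/4)B}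 (div(D_pH(Du^ε)))² dx)^{1/2} (⨍_{(3/4)B} (u^ε−F)²/r² dx)^{1/2}. -/
open MeasureTheory Set Filter Topology Metric Bornology
open scoped Classical ENNReal NNReal

noncomputable section

lemma sq_norm_eq (x : E2) : ‖x‖ ^ 2 = x 0 ^ 2 + x 1 ^ 2 := by
  simp [EuclideanSpace.norm_sq_eq, Fin.sum_univ_two]

lemma sq_norm_gradE (f : E2 → ℝ) (x : E2) : ‖gradE f x‖ ^ 2 = pd f 0 x ^ 2 + pd f 1 x ^ 2 := by
  rw [sq_norm_eq]; rfl

lemma contDiff_pd {f : E2 → ℝ} (hf : ContDiff ℝ (⊤ : ℕ∞) f) (i : Fin 2) :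
    ContDiff ℝ (⊤ : ℕ∞) (pd f i) :=
  (hf.fderiv_right (by simp)).clm_apply contDiff_const

lemma contDiff_gradE {f : E2 → ℝ} (hf : ContDiff ℝ (⊤ : ℕ∞) f) :
    ContDiff ℝ (⊤ : ℕ∞) (gradE f) := by
  unfold gradE
  refine (ContinuousLinearEquiv.contDiff _).comp ?_
  exact contDiff_pi.2 fun i => contDiff_pd hf i

lemma differentiable_of_smooth {f : E2 → ℝ} (hf : ContDiff ℝ (⊤ : ℕ∞) f) :
    Differentiable ℝ f :=
  hf.differentiable (by simp)

lemma pd_add {f g : E2 → ℝ} (hf : Differentiable ℝ f) (hg : Differentiable ℝ g)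
    (i : Fin 2) (x : E2) : pd (fun y => f y + g y) i x = pd f i x + pd g i x := by
  unfold pd
  rw [fderiv_fun_add (hf x) (hg x)]
  rfl

lemma pd_sub {f g : E2 → ℝ} (hf : Differentiable ℝ f) (hg : Differentiable ℝ g)
    (i : Fin 2) (x : E2) : pd (fun y => f y - g y) i x = pd f i x - pd g i x := by
  unfold pd
  rw [fderiv_fun_sub (hf x) (hg x)]
  rfl

lemma pd_mul {f g : E2 → ℝ} (hf : Differentiable ℝ f) (hg : Differentiable ℝ g)
    (i : Fin 2) (x : E2) :
    pd (fun y => f y * g y) i x = f x * pd g i x + g x * pd f i x := by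
  unfold pd
  rw [fderiv_fun_mul (hf x) (hg x)]
  rfl

lemma pd_comm {f : E2 → ℝ} (hf : ContDiff ℝ (⊤ : ℕ∞) f) (i j : Fin 2) (x : E2) :
    pd (pd f i) j x = pd (pd f j) i x := by
  have hd : DifferentiableAt ℝ (fderiv ℝ f) x :=
    ((hf.fderiv_right (m := 1)
      (by exact WithTop.coe_le_coe.2 (le_top : (2 : ℕ∞) ≤ ⊤))).differentiable (by simp)) x
  have h (k l : Fin 2) : pd (pd f k) l x = fderiv ℝ (fderiv ℝ f) x (e2 l) (e2 k) := by
    change fderiv ℝ (fun y => fderiv ℝ f y (e2 k)) x (e2 l) = _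
    rw [fderiv_clm_apply hd (differentiableAt_const _)]
    simp
  rw [h, h]
  exact (hf.contDiffAt.isSymmSndFDerivAt (by
    simpa using WithTop.coe_le_coe.2 (le_top : (2 : ℕ∞) ≤ ⊤))) _ _

lemma fderiv_apply_eq (f : E2 → ℝ) (x ξ : E2) :
    fderiv ℝ f x ξ = ξ 0 * pd f 0 x + ξ 1 * pd f 1 x := by
  have h : ξ = ξ 0 • e2 0 + ξ 1 • e2 1 := by
    ext i
    fin_cases i <;> simp [e2]
  conv_lhs => rw [h]
  simp [pd]

lemma pd_comp_gradE_s6 {G w : E2 → ℝ} (hG : ContDiff ℝ (⊤ : ℕ∞) G) (hw : ContDiff ℝ (⊤ : ℕ∞) w)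
    (i : Fin 2) (x : E2) :
    pd (fun y => G (gradE w y)) i x
      = pd G 0 (gradE w x) * pd (pd w 0) i x + pd G 1 (gradE w x) * pd (pd w 1) i x := by
  have hgd : DifferentiableAt ℝ (gradE w) x := ((contDiff_gradE hw).differentiable (by simp)) x
  have hcoord (k : Fin 2) : (fderiv ℝ (gradE w) x (e2 i)) k = pd (pd w k) i x := by
    have h := ((EuclideanSpace.proj (𝕜 := ℝ) k : E2 →L[ℝ] ℝ).hasFDerivAt.comp x
      hgd.hasFDerivAt).fderiv
    have h' := congrArg (fun L => L (e2 i)) h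
    exact h'.symm
  have h := fderiv_comp x (g := G) (f := gradE w) ((differentiable_of_smooth hG) _) hgd
  have h' := congrArg (fun L => L (e2 i)) h
  change fderiv ℝ (G ∘ gradE w) x (e2 i) = _
  rw [h, ContinuousLinearMap.comp_apply, fderiv_apply_eq, hcoord, hcoord]
  ring

lemma pd_eqOn {f g : E2 → ℝ} {O : Set E2} (hO : IsOpen O) (h : EqOn f g O) (i : Fin 2) :
    EqOn (pd f i) (pd g i) O := by
  intro x hx
  unfold pd
  rw [(Filter.eventuallyEq_of_mem (hO.mem_nhds hx) h).fderiv_eq]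

lemma integral_pd_eq_zero {f : E2 → ℝ} (hf : ContDiff ℝ 1 f) (hc : HasCompactSupport f)
    (i : Fin 2) : ∫ x, pd f i x = 0 := by
  have hcont : Continuous (fun x => fderiv ℝ f x (e2 i)) :=
    (hf.continuous_fderiv (by simp)).clm_apply continuous_const
  have h := integral_smul_fderiv_eq_neg_fderiv_smul_of_integrable (μ := (volume : Measure E2))
    (f := fun _ : E2 => (1 : ℝ)) (g := f) (v := e2 i) (by simp)
    (by simpa using hcont.integrable_of_hasCompactSupport (hc.fderiv_apply ℝ _))
    (by simpa using hf.continuous.integrable_of_hasCompactSupport hc)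
    (fun _ _ => differentiableAt_const _)
    (fun x _ => hf.differentiable (by simp) x)
  simpa [pd] using h

/-- Twice differentiating `η aᵢ aⱼ` against `v² / 2`: the resulting identity for the plane field
`a` involves only `⟨a, Dv⟩`, the field `(a · D) a` and the determinant of `Da`. -/
lemma integral_flatness_identity {a b v η : E2 → ℝ} (ha : ContDiff ℝ (⊤ : ℕ∞) a)
    (hb : ContDiff ℝ (⊤ : ℕ∞) b) (hv : ContDiff ℝ (⊤ : ℕ∞) v) (hη : ContDiff ℝ (⊤ : ℕ∞) η)
    (hc : HasCompactSupport η) :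
    ∫ x, (2 * (v x * (a x * pd v 0 x + b x * pd v 1 x)) * (a x * pd η 0 x + b x * pd η 1 x)
      + 2 * (η x * v x) * ((a x * pd a 0 x + b x * pd a 1 x) * pd v 0 x
          + (a x * pd b 0 x + b x * pd b 1 x) * pd v 1 x)
      + v x ^ 2 * ((a x * pd a 0 x + b x * pd a 1 x) * pd η 0 x
          + (a x * pd b 0 x + b x * pd b 1 x) * pd η 1 x)
      + η x * ((a x * pd v 0 x + b x * pd v 1 x) ^ 2
          + v x * (a x ^ 2 * pd (pd v 0) 0 x + 2 * (a x * b x) * pd (pd v 1) 0 x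
              + b x ^ 2 * pd (pd v 1) 1 x))
      + v x ^ 2 / 2 * (a x ^ 2 * pd (pd η 0) 0 x + 2 * (a x * b x) * pd (pd η 1) 0 x
              + b x ^ 2 * pd (pd η 1) 1 x)
      - η x * v x ^ 2 * (pd a 0 x * pd b 1 x - pd b 0 x * pd a 1 x)) = 0 := by
  have hp (f : E2 → ℝ) (hf : ContDiff ℝ (⊤ : ℕ∞) f) (i : Fin 2) := contDiff_pd hf i
  have hd {f : E2 → ℝ} (hf : ContDiff ℝ (⊤ : ℕ∞) f) := differentiable_of_smooth hf
  set X : E2 → ℝ := fun x =>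
    η x * (v x * (a x * pd v 0 x + b x * pd v 1 x) * a x)
      - η x * (v x * v x * (1 / 2) * (a x * pd b 1 x - b x * pd a 1 x))
      + v x * v x * (1 / 2) * (a x * pd η 0 x + b x * pd η 1 x) * a x with hX
  set Y : E2 → ℝ := fun x =>
    η x * (v x * (a x * pd v 0 x + b x * pd v 1 x) * b x)
      + η x * (v x * v x * (1 / 2) * (a x * pd b 0 x - b x * pd a 0 x))
      + v x * v x * (1 / 2) * (a x * pd η 0 x + b x * pd η 1 x) * b x with hY
  have hv0 := hp v hv 0
  have hv1 := hp v hv 1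
  have ha0 := hp a ha 0
  have ha1 := hp a ha 1
  have hb0 := hp b hb 0
  have hb1 := hp b hb 1
  have hη0 := hp η hη 0
  have hη1 := hp η hη 1
  have hXs : ContDiff ℝ (⊤ : ℕ∞) X := by fun_prop
  have hYs : ContDiff ℝ (⊤ : ℕ∞) Y := by fun_prop
  have hcp (i : Fin 2) : HasCompactSupport (pd η i) := hc.fderiv_apply ℝ _
  have hXc : HasCompactSupport X :=
    ((hc.mul_right).sub (hc.mul_right)).add
      (((((hcp 0).mul_left).add ((hcp 1).mul_left)).mul_left).mul_right)
  have hYc : HasCompactSupport Y :=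
    ((hc.mul_right).add (hc.mul_right)).add
      (((((hcp 0).mul_left).add ((hcp 1).mul_left)).mul_left).mul_right)
  have hX1 : ContDiff ℝ 1 X := hXs.of_le (by exact_mod_cast le_top)
  have hY1 : ContDiff ℝ 1 Y := hYs.of_le (by exact_mod_cast le_top)
  have hint {Z : E2 → ℝ} (hZ : ContDiff ℝ (⊤ : ℕ∞) Z) (hZc : HasCompactSupport Z) (i : Fin 2) :
      Integrable (pd Z i) :=
    (contDiff_pd hZ i).continuous.integrable_of_hasCompactSupport (hZc.fderiv_apply ℝ _)
  rw [← add_zero (0 : ℝ)]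
  nth_rewrite 1 [← integral_pd_eq_zero hX1 hXc 0]
  rw [← integral_pd_eq_zero hY1 hYc 1, ← integral_add (hint hXs hXc 0) (hint hYs hYc 1)]
  congr 1
  ext x
  have ha := hd ha
  have hb := hd hb
  have hv := hd hv
  have hη := hd hη
  have hv0 := hd hv0
  have hv1 := hd hv1
  have ha0 := hd ha0
  have ha1 := hd ha1
  have hb0 := hd hb0
  have hb1 := hd hb1
  have hη0 := hd hη0
  have hη1 := hd hη1
  have hk (i : Fin 2) : pd (fun _ : E2 => (1 / 2 : ℝ)) i x = 0 := by simp [pd]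
  simp (disch := fun_prop) only [hX, hY, pd_add, pd_sub, pd_mul, hk]
  rw [pd_comm ‹ContDiff ℝ (⊤ : ℕ∞) a› 0 1, pd_comm ‹ContDiff ℝ (⊤ : ℕ∞) b› 0 1,
    pd_comm ‹ContDiff ℝ (⊤ : ℕ∞) v› 0 1, pd_comm ‹ContDiff ℝ (⊤ : ℕ∞) η› 0 1]
  ring

lemma hasDerivAt_line {G : E2 → ℝ} (hG : Differentiable ℝ G) (p ξ : E2) (t : ℝ) :
    HasDerivAt (fun s : ℝ => G (p + s • ξ))
      (ξ 0 * pd G 0 (p + t • ξ) + ξ 1 * pd G 1 (p + t • ξ)) t := by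
  have h1 : HasDerivAt (fun s : ℝ => p + s • ξ) ξ t := by
    simpa using ((hasDerivAt_id t).smul_const ξ).const_add p
  have h := (hG (p + t • ξ)).hasFDerivAt.comp_hasDerivAt t h1
  rwa [fderiv_apply_eq] at h

lemma convexOn_line {G : E2 → ℝ} (hG : ConvexOn ℝ univ G) (p ξ : E2) :
    ConvexOn ℝ univ (fun s : ℝ => G (p + s • ξ)) := by
  have h := hG.comp_affineMap (AffineMap.lineMap p (p + ξ) : ℝ →ᵃ[ℝ] E2)
  have he : G ∘ (AffineMap.lineMap p (p + ξ) : ℝ →ᵃ[ℝ] E2) = fun s : ℝ => G (p + s • ξ) := by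
    ext s
    simp [AffineMap.lineMap_apply, add_comm]
  rwa [he, preimage_univ] at h

lemma ConvexOn.pd_le_sub {G : E2 → ℝ} (hG : Differentiable ℝ G) (hc : ConvexOn ℝ univ G)
    (p ξ : E2) : ξ 0 * pd G 0 p + ξ 1 * pd G 1 p ≤ G (p + ξ) - G p := by
  have h := (convexOn_line hc p ξ).le_slope_of_hasDerivAt (mem_univ 0) (mem_univ 1) one_pos
    (hasDerivAt_line hG p ξ 0)
  simpa [slope_def_field] using h

lemma ConvexOn.hess_nonneg {G : E2 → ℝ} (hG : ContDiff ℝ (⊤ : ℕ∞) G) (hc : ConvexOn ℝ univ G)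
    (p : E2) (s t : ℝ) :
    0 ≤ s ^ 2 * pd (pd G 0) 0 p + 2 * (s * t) * pd (pd G 1) 0 p + t ^ 2 * pd (pd G 1) 1 p := by
  set ξ : E2 := !₂[s, t]
  have hd := hasDerivAt_line (differentiable_of_smooth hG) p ξ
  have hmono : Monotone fun τ : ℝ => ξ 0 * pd G 0 (p + τ • ξ) + ξ 1 * pd G 1 (p + τ • ξ) := by
    have h := (convexOn_line hc p ξ).monotoneOn_deriv fun τ _ => (hd τ).differentiableAt
    rw [monotoneOn_univ, funext fun τ => (hd τ).deriv] at h
    exact h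
  have h2 := ((hasDerivAt_line (differentiable_of_smooth (contDiff_pd hG 0)) p ξ 0).const_mul
    (ξ 0)).add ((hasDerivAt_line (differentiable_of_smooth (contDiff_pd hG 1)) p ξ 0).const_mul
    (ξ 1))
  have h3 := h2.deriv.symm ▸ hmono.deriv_nonneg (x := 0)
  simp only [zero_smul, add_zero, pd_comm hG 0 1] at h3
  have e0 : ξ 0 = s := rfl
  have e1 : ξ 1 = t := rfl
  rw [e0, e1] at h3
  linarith

lemma pd_norm_sq (i : Fin 2) (x : E2) : pd (fun y : E2 => ‖y‖ ^ 2) i x = 2 * x i := by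
  unfold pd
  rw [(hasStrictFDerivAt_norm_sq x).hasFDerivAt.fderiv]
  simp [e2, EuclideanSpace.inner_single_right]

lemma pd_const_mul_norm_sq (l : ℝ) (i : Fin 2) :
    pd (fun y : E2 => l / 2 * ‖y‖ ^ 2) i = fun x => l * x i := by
  ext x
  rw [pd_mul (differentiable_const _)
    ((contDiff_norm_sq ℝ (n := 1)).differentiable (by simp)), pd_norm_sq]
  simp [pd]
  ring

lemma pd_coord (l : ℝ) (i j : Fin 2) (x : E2) :
    pd (fun y : E2 => l * y i) j x = if i = j then l else 0 := by
  have h : HasFDerivAt (fun y : E2 => l * y i) (l • (EuclideanSpace.proj (𝕜 := ℝ) i : E2 →L[ℝ] ℝ))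
      x := ((EuclideanSpace.proj (𝕜 := ℝ) i : E2 →L[ℝ] ℝ).hasFDerivAt).const_mul l
  unfold pd
  rw [h.fderiv]
  fin_cases i <;> fin_cases j <;> simp [e2]

lemma contDiff_const_mul_norm_sq (l : ℝ) :
    ContDiff ℝ (⊤ : ℕ∞) (fun y : E2 => l / 2 * ‖y‖ ^ 2) :=
  contDiff_const.mul (contDiff_norm_sq ℝ)

lemma hess_lower {H : E2 → ℝ} (hH : ContDiff ℝ (⊤ : ℕ∞) H) {l : ℝ}
    (hc : ConvexOn ℝ univ (fun p => H p - l / 2 * ‖p‖ ^ 2)) (p : E2) (s t : ℝ) :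
    l * (s ^ 2 + t ^ 2)
      ≤ s ^ 2 * pd (pd H 0) 0 p + 2 * (s * t) * pd (pd H 1) 0 p + t ^ 2 * pd (pd H 1) 1 p := by
  have hq := contDiff_const_mul_norm_sq l
  have h := hc.hess_nonneg (hH.sub hq) p s t
  have e (i : Fin 2) : pd (fun p => H p - l / 2 * ‖p‖ ^ 2) i = fun x => pd H i x - l * x i := by
    ext x
    rw [pd_sub (differentiable_of_smooth hH) (differentiable_of_smooth hq), pd_const_mul_norm_sq]
  have e' (i j : Fin 2) := pd_sub (differentiable_of_smooth (contDiff_pd hH i))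
    (g := fun x => l * x i) (by fun_prop) j p
  simp only [e, e', pd_coord] at h
  simp at h
  linarith

lemma hess_upper {H : E2 → ℝ} (hH : ContDiff ℝ (⊤ : ℕ∞) H) {L : ℝ}
    (hc : ConvexOn ℝ univ (fun p => L / 2 * ‖p‖ ^ 2 - H p)) (p : E2) (s t : ℝ) :
    s ^ 2 * pd (pd H 0) 0 p + 2 * (s * t) * pd (pd H 1) 0 p + t ^ 2 * pd (pd H 1) 1 p
      ≤ L * (s ^ 2 + t ^ 2) := by
  have hq := contDiff_const_mul_norm_sq L
  have h := hc.hess_nonneg (hq.sub hH) p s t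
  have e (i : Fin 2) : pd (fun p => L / 2 * ‖p‖ ^ 2 - H p) i = fun x => L * x i - pd H i x := by
    ext x
    rw [pd_sub (differentiable_of_smooth hq) (differentiable_of_smooth hH), pd_const_mul_norm_sq]
  have e' (i j : Fin 2) := pd_sub (f := fun x => L * x i) (by fun_prop)
    (differentiable_of_smooth (contDiff_pd hH i)) j p
  simp only [e, e', pd_coord] at h
  simp at h
  linarith

lemma sq_pd_le {H : E2 → ℝ} (hH : ContDiff ℝ (⊤ : ℕ∞) H) (h0 : ∀ p, 0 ≤ H p) {L : ℝ}
    (hL : 0 < L) (hc : ConvexOn ℝ univ (fun p => L / 2 * ‖p‖ ^ 2 - H p)) (p : E2) :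
    pd H 0 p ^ 2 + pd H 1 p ^ 2 ≤ 2 * L * H p := by
  set ξ : E2 := !₂[-(pd H 0 p / L), -(pd H 1 p / L)]
  have hq := contDiff_const_mul_norm_sq L
  have h := hc.pd_le_sub (differentiable_of_smooth (hq.sub hH)) p ξ
  have e (i : Fin 2) : pd (fun p => L / 2 * ‖p‖ ^ 2 - H p) i p = L * p i - pd H i p := by
    rw [pd_sub (differentiable_of_smooth hq) (differentiable_of_smooth hH), pd_const_mul_norm_sq]
  have e0 : ξ 0 = -(pd H 0 p / L) := rfl
  have e1 : ξ 1 = -(pd H 1 p / L) := rfl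
  simp only [e] at h
  simp only [sq_norm_eq, PiLp.add_apply, e0, e1] at h
  have hp := h0 (p + ξ)
  obtain ⟨x, hx⟩ : ∃ x, pd H 0 p = L * x := ⟨pd H 0 p / L, by field_simp⟩
  obtain ⟨y, hy⟩ : ∃ y, pd H 1 p = L * y := ⟨pd H 1 p / L, by field_simp⟩
  rw [hx, hy, mul_div_cancel_left₀ _ hL.ne', mul_div_cancel_left₀ _ hL.ne'] at h
  have key : L * (x ^ 2 + y ^ 2) ≤ 2 * H p := by linarith
  rw [hx, hy]
  have := mul_le_mul_of_nonneg_left key hL.le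
  linarith

/-- The optimal convexity constants of a function satisfying (H1')&(H2) are positive, ordered and
bound the Hessian and the gradient. -/
lemma StrongH.bounds {H : E2 → ℝ} (hH : ContDiff ℝ (⊤ : ℕ∞) H) (hS : StrongH H) :
    0 < lamInf H ∧ lamInf H ≤ LamInf H ∧
    (∀ p s t, lamInf H * (s ^ 2 + t ^ 2)
      ≤ s ^ 2 * pd (pd H 0) 0 p + 2 * (s * t) * pd (pd H 1) 0 p + t ^ 2 * pd (pd H 1) 1 p) ∧
    (∀ p s t, s ^ 2 * pd (pd H 0) 0 p + 2 * (s * t) * pd (pd H 1) 0 p + t ^ 2 * pd (pd H 1) 1 p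
      ≤ LamInf H * (s ^ 2 + t ^ 2)) ∧
    ∀ p, pd H 0 p ^ 2 + pd H 1 p ^ 2 ≤ 2 * LamInf H * H p := by
  obtain ⟨-, h0, l, L, hl, hlL, hcl, hcL⟩ := hS
  have hle {l' L' : ℝ} (h1 : ConvexOn ℝ univ (fun p => H p - l' / 2 * ‖p‖ ^ 2))
      (h2 : ConvexOn ℝ univ (fun p => L' / 2 * ‖p‖ ^ 2 - H p)) : l' ≤ L' := by
    simpa using (hess_lower hH h1 0 1 0).trans (hess_upper hH h2 0 1 0)
  have hbdd : BddAbove {l : ℝ | 0 < l ∧ ConvexOn ℝ univ (fun p => H p - l / 2 * ‖p‖ ^ 2)} :=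
    ⟨L, fun l' h => hle h.2 hcL⟩
  have hne : {L : ℝ | 0 < L ∧ ConvexOn ℝ univ (fun p => L / 2 * ‖p‖ ^ 2 - H p)}.Nonempty :=
    ⟨L, hl.trans_le hlL, hcL⟩
  have hnel : {l : ℝ | 0 < l ∧ ConvexOn ℝ univ (fun p => H p - l / 2 * ‖p‖ ^ 2)}.Nonempty :=
    ⟨l, hl, hcl⟩
  have hpos : 0 < lamInf H := hl.trans_le (le_csSup hbdd ⟨hl, hcl⟩)
  have hord : lamInf H ≤ LamInf H :=
    csSup_le hnel fun l' h' => le_csInf hne fun L' h'' => hle h'.2 h''.2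
  have hLam {m k : ℝ} (hk : 0 ≤ k) (h : ∀ L', 0 < L' →
      ConvexOn ℝ univ (fun p => L' / 2 * ‖p‖ ^ 2 - H p) → m ≤ L' * k) : m ≤ LamInf H * k := by
    rcases hk.eq_or_lt with rfl | hk
    · simpa using h L (hl.trans_le hlL) hcL
    · rw [← div_le_iff₀ hk]
      exact le_csInf hne fun L' h' => (div_le_iff₀ hk).2 (h L' h'.1 h'.2)
  refine ⟨hpos, hord, fun p s t => ?_, fun p s t => ?_, fun p => ?_⟩
  · rcases (by positivity : 0 ≤ s ^ 2 + t ^ 2).eq_or_lt with hk | hk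
    · rw [← hk, mul_zero]
      simpa [← hk] using hess_lower hH hcl p s t
    · rw [← le_div_iff₀ hk]
      exact csSup_le hnel fun l' h' => (le_div_iff₀ hk).2 (hess_lower hH h'.2 p s t)
  · exact hLam (by positivity) fun L' _ h => hess_upper hH h p s t
  · have h := hLam (m := pd H 0 p ^ 2 + pd H 1 p ^ 2) (k := 2 * H p)
      (by linarith [h0 p]) fun L' hL' h => by linarith [sq_pd_le hH h0 hL' h p]
    linarith

lemma pd_scale {f : E2 → ℝ} (hf : Differentiable ℝ f) (xb : E2) (s : ℝ) (i : Fin 2) (x : E2) :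
    pd (fun y => f (s • (y - xb))) i x = s * pd f i (s • (x - xb)) := by
  have h1 : HasFDerivAt (fun y : E2 => s • (y - xb)) (s • ContinuousLinearMap.id ℝ E2) x :=
    ((hasFDerivAt_id x).sub_const xb).const_smul s
  have h := (hf (s • (x - xb))).hasFDerivAt.comp x h1
  unfold pd
  rw [show (fun y => f (s • (y - xb))) = f ∘ fun y => s • (y - xb) from rfl, h.fderiv]
  simp

lemma pd_const_mul {f : E2 → ℝ} (hf : Differentiable ℝ f) (c : ℝ) (i : Fin 2) (x : E2) :
    pd (fun y => c * f y) i x = c * pd f i x := by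
  rw [pd_mul (differentiable_const c) hf]
  simp [pd]

lemma exists_bound_of_compactSupport {f : E2 → ℝ} (hf : Continuous f) (hc : HasCompactSupport f) :
    ∃ K, 0 < K ∧ ∀ x, |f x| ≤ K := by
  obtain ⟨K, hK⟩ := hf.bounded_above_of_compact_support hc
  exact ⟨max K 1, by positivity, fun x => (hK x).trans (le_max_left _ _)⟩

lemma exists_unit_cutoff :
    ∃ K : ℝ, 0 < K ∧ ∃ η : E2 → ℝ, ContDiff ℝ (⊤ : ℕ∞) η ∧
      (∀ x, 0 ≤ η x) ∧ (∀ x, η x ≤ 1) ∧ (∀ x ∈ ball (0 : E2) (1 / 2), η x = 1) ∧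
      (∀ x ∉ ball (0 : E2) (3 / 4), η x = 0) ∧
      (∀ i, ∀ x ∉ ball (0 : E2) (3 / 4), pd η i x = 0) ∧
      (∀ i j, ∀ x ∉ ball (0 : E2) (3 / 4), pd (pd η i) j x = 0) ∧
      (∀ i x, pd η i x ^ 2 ≤ K * η x) ∧ (∀ i j x, |pd (pd η i) j x| ≤ K) := by
  let φ : ContDiffBump (0 : E2) := ⟨1 / 2, 3 / 4, by norm_num, by norm_num⟩
  set ζ : E2 → ℝ := fun x => φ x
  have hs : ContDiff ℝ (⊤ : ℕ∞) ζ := φ.contDiff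
  have hsi (i : Fin 2) := contDiff_pd hs i
  have hd := differentiable_of_smooth hs
  have hdi (i : Fin 2) := differentiable_of_smooth (hsi i)
  have hc : HasCompactSupport ζ := φ.hasCompactSupport
  have hci (i : Fin 2) : HasCompactSupport (pd ζ i) := hc.fderiv_apply ℝ _
  have h0 (x : E2) : 0 ≤ ζ x := φ.nonneg
  have h1 (x : E2) : ζ x ≤ 1 := φ.le_one
  have hz : ∀ x ∉ ball (0 : E2) (3 / 4), ζ x = 0 := fun x hx => by
    refine φ.zero_of_le_dist ?_
    simpa using hx
  choose K hK0 hK using fun i => exists_bound_of_compactSupport (hsi i).continuous (hci i)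
  choose M hM0 hM using fun i j => exists_bound_of_compactSupport
    (contDiff_pd (hsi i) j).continuous ((hci i).fderiv_apply ℝ (e2 j))
  obtain ⟨N, hN1, hKN, hMN⟩ : ∃ N, 1 ≤ N ∧ (∀ i, K i ≤ N) ∧ ∀ i j, M i j ≤ N := by
    refine ⟨1 + ∑ i, K i + ∑ i, ∑ j, M i j, ?_, fun i => ?_, fun i j => ?_⟩ <;>
    simp only [Fin.sum_univ_two]
    · linarith [hK0 0, hK0 1, hM0 0 0, hM0 0 1, hM0 1 0, hM0 1 1]
    · fin_cases i <;> simp <;> linarith [hK0 0, hK0 1, hM0 0 0, hM0 0 1, hM0 1 0, hM0 1 1]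
    · fin_cases i <;> fin_cases j <;> simp <;>
        linarith [hK0 0, hK0 1, hM0 0 0, hM0 0 1, hM0 1 0, hM0 1 1]
  have e1 (i : Fin 2) : pd (fun x => ζ x * ζ x * ζ x) i = fun x => 3 * (ζ x * ζ x * pd ζ i x) := by
    ext x
    simp (disch := fun_prop) only [pd_mul]
    ring
  have e2 (i j : Fin 2) (x : E2) : pd (pd (fun x => ζ x * ζ x * ζ x) i) j x
      = 3 * (ζ x * ζ x * pd (pd ζ i) j x + 2 * ζ x * pd ζ i x * pd ζ j x) := by
    have := hdi i
    rw [e1, pd_const_mul (by fun_prop)]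
    simp (disch := fun_prop) only [pd_mul]
    ring
  refine ⟨9 * N ^ 2, by positivity, fun x => ζ x * ζ x * ζ x, by fun_prop,
    fun x => by have := h0 x; positivity, fun x => ?_, fun x hx => ?_, fun x hx => ?_,
    fun i x hx => ?_, fun i j x hx => ?_, fun i x => ?_, fun i j x => ?_⟩
  · calc ζ x * ζ x * ζ x ≤ 1 * 1 * 1 := by gcongr <;> simp [h0, h1]
      _ = 1 := by norm_num
  · have : ζ x = 1 := φ.one_of_mem_closedBall (ball_subset_closedBall hx)
    simp [this]
  · simp [hz x hx]
  · simp [e1, hz x hx]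
  · simp [e2, hz x hx]
  · rw [e1]
    have a1 : pd ζ i x ^ 2 ≤ N ^ 2 := by
      rw [← sq_abs]
      gcongr
      exact (hK i x).trans (hKN i)
    have a2 : ζ x * (ζ x * ζ x * ζ x) ≤ 1 * (ζ x * ζ x * ζ x) := by
      gcongr
      · have := h0 x; positivity
      · exact h1 x
    calc (3 * (ζ x * ζ x * pd ζ i x)) ^ 2 = 9 * (ζ x * (ζ x * ζ x * ζ x)) * pd ζ i x ^ 2 := by ring
      _ ≤ 9 * (1 * (ζ x * ζ x * ζ x)) * N ^ 2 := by
        have := h0 x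
        gcongr
      _ = 9 * N ^ 2 * (ζ x * ζ x * ζ x) := by ring
  · rw [e2]
    have b1 (k : Fin 2) : |pd ζ k x| ≤ N := (hK k x).trans (hKN k)
    have b2 : |pd (pd ζ i) j x| ≤ N := (hM i j x).trans (hMN i j)
    have b3 : |ζ x| ≤ 1 := by rw [abs_of_nonneg (h0 x)]; exact h1 x
    calc |3 * (ζ x * ζ x * pd (pd ζ i) j x + 2 * ζ x * pd ζ i x * pd ζ j x)|
        ≤ 3 * (|ζ x| * |ζ x| * |pd (pd ζ i) j x| + 2 * |ζ x| * |pd ζ i x| * |pd ζ j x|) := by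
          rw [abs_mul, abs_of_pos (by norm_num : (0 : ℝ) < 3)]
          gcongr
          refine (abs_add_le _ _).trans ?_
          simp [abs_mul]
      _ ≤ 3 * (1 * 1 * N + 2 * 1 * N * N) := by
          gcongr <;> first | exact b3 | exact b2 | exact b1 _
      _ ≤ 9 * N ^ 2 := by nlinarith

lemma exists_cutoff :
    ∃ K : ℝ, 0 < K ∧ ∀ (xb : E2) (r : ℝ), 0 < r → ∃ η : E2 → ℝ, ContDiff ℝ (⊤ : ℕ∞) η ∧
      HasCompactSupport η ∧
      (∀ x, 0 ≤ η x) ∧ (∀ x, η x ≤ 1) ∧ (∀ x ∈ ball xb (r / 2), η x = 1) ∧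
      (∀ x ∉ ball xb (3 * r / 4), η x = 0) ∧
      (∀ i, ∀ x ∉ ball xb (3 * r / 4), pd η i x = 0) ∧
      (∀ i j, ∀ x ∉ ball xb (3 * r / 4), pd (pd η i) j x = 0) ∧
      (∀ i x, pd η i x ^ 2 ≤ K * η x / r ^ 2) ∧ (∀ i j x, |pd (pd η i) j x| ≤ K / r ^ 2) := by
  obtain ⟨K, hK, η, hs, h0, h1, hone, hz, hz1, hz2, hb1, hb2⟩ := exists_unit_cutoff
  refine ⟨K, hK, fun xb r hr => ?_⟩
  have hmem (x : E2) (s : ℝ) : r⁻¹ • (x - xb) ∈ ball (0 : E2) s ↔ x ∈ ball xb (s * r) := by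
    rw [mem_ball_zero_iff, norm_smul, mem_ball, dist_eq_norm, norm_inv, Real.norm_eq_abs,
      abs_of_pos hr, inv_mul_lt_iff₀ hr, mul_comm r]
  have hout {x : E2} (hx : x ∉ ball xb (3 * r / 4)) : r⁻¹ • (x - xb) ∉ ball (0 : E2) (3 / 4) := by
    rw [hmem]
    convert hx using 3
    ring
  have e1 (i : Fin 2) : pd (fun x => η (r⁻¹ • (x - xb))) i
      = fun x => r⁻¹ * pd η i (r⁻¹ • (x - xb)) := by
    ext x
    exact pd_scale (differentiable_of_smooth hs) xb _ i x
  have e2 (i j : Fin 2) (x : E2) : pd (pd (fun x => η (r⁻¹ • (x - xb))) i) j x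
      = r⁻¹ * (r⁻¹ * pd (pd η i) j (r⁻¹ • (x - xb))) := by
    have hd := differentiable_of_smooth (contDiff_pd hs i)
    rw [e1, pd_const_mul (f := fun x => pd η i (r⁻¹ • (x - xb))) (hd.comp (by fun_prop)),
      pd_scale hd]
  refine ⟨fun x => η (r⁻¹ • (x - xb)), by fun_prop, ?_, fun x => h0 _, fun x => h1 _,
    fun x hx => hone _ ?_, fun x hx => hz _ (hout hx), fun i x hx => ?_, fun i j x hx => ?_,
    fun i x => ?_, fun i j x => ?_⟩
  · refine HasCompactSupport.intro (isCompact_closedBall xb (3 * r / 4)) fun x hx => ?_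
    exact hz _ (hout fun h => hx (ball_subset_closedBall h))
  · rw [hmem]
    convert hx using 2
    ring
  · simp [e1, hz1 i _ (hout hx)]
  · simp [e2, hz2 i j _ (hout hx)]
  · rw [e1, mul_pow, inv_pow, inv_mul_eq_div]
    gcongr
    exact hb1 _ _
  · rw [e2, ← mul_assoc, abs_mul, ← mul_inv, ← sq, abs_of_pos (by positivity : 0 < (r ^ 2)⁻¹),
      inv_mul_eq_div]
    gcongr
    exact hb2 _ _ _

/-- For `Da = S M` with `S` positive definite and `M` symmetric, a relation
`⟨a, M a⟩ = - ε tr (S M)` forces `det (S M) ≤ 0`. -/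
lemma det_mul_nonpos {s₀ s₁ s₂ m₀ m₁ m₂ a b ε : ℝ} (hs : 0 < s₀) (hs' : 0 < s₀ * s₂ - s₁ ^ 2)
    (hpos : ∀ s t, 0 ≤ s ^ 2 * s₀ + 2 * (s * t) * s₁ + t ^ 2 * s₂) (hε : 0 < ε)
    (h : a * (a * m₀ + b * m₁) + b * (a * m₁ + b * m₂)
      + ε * (s₀ * m₀ + s₁ * m₁ + (s₁ * m₁ + s₂ * m₂)) = 0) :
    (s₀ * m₀ + s₁ * m₁) * (s₁ * m₁ + s₂ * m₂)
      - (s₁ * m₀ + s₂ * m₁) * (s₀ * m₁ + s₁ * m₂) ≤ 0 := by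
  have e : (s₀ * m₀ + s₁ * m₁) * (s₁ * m₁ + s₂ * m₂)
      - (s₁ * m₀ + s₂ * m₁) * (s₀ * m₁ + s₁ * m₂)
      = (s₀ * s₂ - s₁ ^ 2) * (m₀ * m₂ - m₁ ^ 2) := by ring
  rw [e]
  refine mul_nonpos_of_nonneg_of_nonpos hs'.le ?_
  by_cases hab : a = 0 ∧ b = 0
  · obtain ⟨rfl, rfl⟩ := hab
    have hg : s₀ * m₀ + s₁ * m₁ + (s₁ * m₁ + s₂ * m₂) = 0 := by
      simpa [hε.ne'] using h
    have hs2 : 0 < s₀ * s₂ := by nlinarith [sq_nonneg s₁]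
    have h1 : (s₀ * m₀ + s₂ * m₂) ^ 2 = 4 * s₁ ^ 2 * m₁ ^ 2 := by
      rw [show s₀ * m₀ + s₂ * m₂ = -(2 * s₁ * m₁) by linarith]
      ring
    have h2 : s₀ * s₂ * (m₀ * m₂ - m₁ ^ 2) ≤ 0 := by
      nlinarith [sq_nonneg (s₀ * m₀ - s₂ * m₂), mul_nonneg hs'.le (sq_nonneg m₁)]
    exact nonpos_of_mul_nonpos_right h2 hs2
  · have hq : 0 < s₀ * b ^ 2 - 2 * s₁ * (a * b) + s₂ * a ^ 2 := by
      have h3 : s₀ * (s₀ * b ^ 2 - 2 * s₁ * (a * b) + s₂ * a ^ 2)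
          = (s₀ * b - s₁ * a) ^ 2 + (s₀ * s₂ - s₁ ^ 2) * a ^ 2 := by ring
      refine pos_of_mul_pos_right ?_ hs.le
      rw [h3]
      by_cases ha : a = 0
      · have hb : b ≠ 0 := fun hb => hab ⟨ha, hb⟩
        subst ha
        have : 0 < (s₀ * b) ^ 2 := by positivity
        simpa using this
      · positivity
    have h4 := hpos (a * m₀ + b * m₁) (a * m₁ + b * m₂)
    have h5 : (s₀ * b ^ 2 - 2 * s₁ * (a * b) + s₂ * a ^ 2) * (m₀ * m₂ - m₁ ^ 2)
        = (s₀ * m₀ + s₁ * m₁ + (s₁ * m₁ + s₂ * m₂))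
            * (a * (a * m₀ + b * m₁) + b * (a * m₁ + b * m₂))
          - ((a * m₀ + b * m₁) ^ 2 * s₀ + 2 * ((a * m₀ + b * m₁) * (a * m₁ + b * m₂)) * s₁
            + (a * m₁ + b * m₂) ^ 2 * s₂) := by ring
    refine nonpos_of_mul_nonpos_right (a := s₀ * b ^ 2 - 2 * s₁ * (a * b) + s₂ * a ^ 2) ?_ hq
    rw [h5, show a * (a * m₀ + b * m₁) + b * (a * m₁ + b * m₂)
      = -(ε * (s₀ * m₀ + s₁ * m₁ + (s₁ * m₁ + s₂ * m₂))) by linarith]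
    nlinarith [mul_nonneg hε.le (sq_nonneg (s₀ * m₀ + s₁ * m₁ + (s₁ * m₁ + s₂ * m₂)))]

lemma abs_bilin_le {s₀ s₁ s₂ L x₀ x₁ y₀ y₁ X Y : ℝ} (hL : 0 ≤ L) (hX : 0 ≤ X) (hY : 0 ≤ Y)
    (hdet : 0 ≤ s₀ * s₂ - s₁ ^ 2)
    (hpos : ∀ s t, 0 ≤ s ^ 2 * s₀ + 2 * (s * t) * s₁ + t ^ 2 * s₂)
    (hle : ∀ s t, s ^ 2 * s₀ + 2 * (s * t) * s₁ + t ^ 2 * s₂ ≤ L * (s ^ 2 + t ^ 2))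
    (hx : x₀ ^ 2 + x₁ ^ 2 ≤ X ^ 2) (hy : y₀ ^ 2 + y₁ ^ 2 ≤ Y ^ 2) :
    |(s₀ * x₀ + s₁ * x₁) * y₀ + (s₁ * x₀ + s₂ * x₁) * y₁| ≤ L * X * Y := by
  refine abs_le_of_sq_le_sq ?_ (by positivity)
  have h1 := (hle x₀ x₁).trans (mul_le_mul_of_nonneg_left hx hL)
  have h2 := (hle y₀ y₁).trans (mul_le_mul_of_nonneg_left hy hL)
  have h3 := mul_le_mul h1 h2 (hpos _ _) (by positivity)
  nlinarith [mul_nonneg hdet (sq_nonneg (x₀ * y₁ - x₁ * y₀))]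

set_option maxHeartbeats 1000000 in
/-- The pointwise lower bound for the integrand of `integral_flatness_identity`. -/
lemma flatness_integrand_lower {s₀ s₁ s₂ m₀ m₁ m₂ a b ε v d₀ d₁ η η₀ η₁ η₀₀ η₁₀ η₁₁ r K l L h G P
    g : ℝ} (hr : 0 < r) (hK : 1 ≤ K) (hl : 0 < l) (hlL : l ≤ L) (hε : 0 < ε) (hη0 : 0 ≤ η)
    (hη1 : η ≤ 1) (hG : 0 ≤ G) (hP : 0 ≤ P) (hh : 0 ≤ h)
    (hlow : ∀ s t, l * (s ^ 2 + t ^ 2) ≤ s ^ 2 * s₀ + 2 * (s * t) * s₁ + t ^ 2 * s₂)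
    (hup : ∀ s t, s ^ 2 * s₀ + 2 * (s * t) * s₁ + t ^ 2 * s₂ ≤ L * (s ^ 2 + t ^ 2))
    (hab : a ^ 2 + b ^ 2 ≤ 2 * L * h)
    (hg : g = s₀ * m₀ + s₁ * m₁ + (s₁ * m₁ + s₂ * m₂))
    (hpde : a * (a * m₀ + b * m₁) + b * (a * m₁ + b * m₂) + ε * g = 0)
    (hGh : (a * m₀ + b * m₁) ^ 2 + (a * m₁ + b * m₂) ^ 2 = G ^ 2)
    (hd : d₀ ^ 2 + d₁ ^ 2 ≤ P ^ 2)
    (h0 : η₀ ^ 2 ≤ K ^ 2 * η / r ^ 2) (h1 : η₁ ^ 2 ≤ K ^ 2 * η / r ^ 2)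
    (h00 : |η₀₀| ≤ K ^ 2 / r ^ 2) (h10 : |η₁₀| ≤ K ^ 2 / r ^ 2) (h11 : |η₁₁| ≤ K ^ 2 / r ^ 2) :
    η * (a * d₀ + b * d₁) ^ 2 / 2 - (ε * (|v| * |g|) + 2 * K * L * (G * (|v| * P + v ^ 2 / r))
        + 10 * K ^ 2 * (L ^ 2 / l) * (h * (v ^ 2 / r ^ 2)))
      ≤ 2 * (v * (a * d₀ + b * d₁)) * (a * η₀ + b * η₁)
      + 2 * (η * v) * ((a * (s₀ * m₀ + s₁ * m₁) + b * (s₀ * m₁ + s₁ * m₂)) * d₀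
          + (a * (s₁ * m₀ + s₂ * m₁) + b * (s₁ * m₁ + s₂ * m₂)) * d₁)
      + v ^ 2 * ((a * (s₀ * m₀ + s₁ * m₁) + b * (s₀ * m₁ + s₁ * m₂)) * η₀
          + (a * (s₁ * m₀ + s₂ * m₁) + b * (s₁ * m₁ + s₂ * m₂)) * η₁)
      + η * ((a * d₀ + b * d₁) ^ 2
          + v * (a ^ 2 * m₀ + 2 * (a * b) * m₁ + b ^ 2 * m₂))
      + v ^ 2 / 2 * (a ^ 2 * η₀₀ + 2 * (a * b) * η₁₀ + b ^ 2 * η₁₁)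
      - η * v ^ 2 * ((s₀ * m₀ + s₁ * m₁) * (s₁ * m₁ + s₂ * m₂)
          - (s₁ * m₀ + s₂ * m₁) * (s₀ * m₁ + s₁ * m₂)) := by
  have hL : 0 < L := hl.trans_le hlL
  have hpos (s t : ℝ) : 0 ≤ s ^ 2 * s₀ + 2 * (s * t) * s₁ + t ^ 2 * s₂ :=
    (by positivity : 0 ≤ l * (s ^ 2 + t ^ 2)).trans (hlow s t)
  have hs0 : 0 < s₀ := by
    have := hlow 1 0
    norm_num at this
    linarith
  have hdet : 0 < s₀ * s₂ - s₁ ^ 2 := by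
    have h2 := hlow (-s₁) s₀
    have h3 : 0 < l * ((-s₁) ^ 2 + s₀ ^ 2) := by positivity
    refine pos_of_mul_pos_right (a := s₀) ?_ hs0.le
    nlinarith
  have hD := det_mul_nonpos hs0 hdet hpos hε (hg ▸ hpde)
  set x₀ := a * m₀ + b * m₁ with hx₀
  set x₁ := a * m₁ + b * m₂ with hx₁
  have e0 : a * (s₀ * m₀ + s₁ * m₁) + b * (s₀ * m₁ + s₁ * m₂) = s₀ * x₀ + s₁ * x₁ := by
    rw [hx₀, hx₁]; ring
  have e1 : a * (s₁ * m₀ + s₂ * m₁) + b * (s₁ * m₁ + s₂ * m₂) = s₁ * x₀ + s₂ * x₁ := by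
    rw [hx₀, hx₁]; ring
  have e2 : a ^ 2 * m₀ + 2 * (a * b) * m₁ + b ^ 2 * m₂ = -(ε * g) := by
    have : a ^ 2 * m₀ + 2 * (a * b) * m₁ + b ^ 2 * m₂ = a * x₀ + b * x₁ := by
      rw [hx₀, hx₁]; ring
    linarith
  rw [e0, e1, e2]
  have hηle : η₀ ^ 2 + η₁ ^ 2 ≤ 2 * K ^ 2 * η / r ^ 2 := by
    have : 2 * K ^ 2 * η / r ^ 2 = K ^ 2 * η / r ^ 2 + K ^ 2 * η / r ^ 2 := by ring
    linarith
  have hηle' : η₀ ^ 2 + η₁ ^ 2 ≤ (2 * K / r) ^ 2 := by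
    refine hηle.trans ?_
    rw [div_pow]
    gcongr
    nlinarith [mul_le_mul_of_nonneg_left hη1 (sq_nonneg K), sq_nonneg K]
  have b1 := abs_bilin_le hL.le hG hP hdet.le hpos hup hGh.le hd
  have b2 := abs_bilin_le hL.le hG (by positivity : 0 ≤ 2 * K / r) hdet.le hpos hup hGh.le hηle'
  set θ := a * d₀ + b * d₁
  have t1 : -(η * θ ^ 2 / 2 + 4 * K ^ 2 * (v ^ 2 * (a ^ 2 + b ^ 2) / r ^ 2))
      ≤ 2 * (v * θ) * (a * η₀ + b * η₁) := by
    have c1 : (a * η₀ + b * η₁) ^ 2 ≤ η * (2 * K ^ 2 * (a ^ 2 + b ^ 2) / r ^ 2) := by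
      calc (a * η₀ + b * η₁) ^ 2 ≤ (a ^ 2 + b ^ 2) * (η₀ ^ 2 + η₁ ^ 2) := by
            nlinarith [sq_nonneg (a * η₁ - b * η₀)]
        _ ≤ (a ^ 2 + b ^ 2) * (2 * K ^ 2 * η / r ^ 2) := by gcongr
        _ = _ := by ring
    set Q := 2 * K ^ 2 * (a ^ 2 + b ^ 2) / r ^ 2 with hQ
    have hQ0 : 0 ≤ Q := by positivity
    have c2 : |2 * (v * θ) * (a * η₀ + b * η₁)| ≤ η * θ ^ 2 / 2 + 2 * (v ^ 2 * Q) := by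
      refine abs_le_of_sq_le_sq ?_ (by positivity)
      have c3 : (v * θ) ^ 2 * (a * η₀ + b * η₁) ^ 2 ≤ (v * θ) ^ 2 * (η * Q) := by gcongr
      nlinarith [sq_nonneg (η * θ ^ 2 / 2 - 2 * (v ^ 2 * Q))]
    have c4 : 2 * (v ^ 2 * Q) = 4 * K ^ 2 * (v ^ 2 * (a ^ 2 + b ^ 2) / r ^ 2) := by
      rw [hQ]; ring
    rw [← c4]
    exact (abs_le.1 c2).1
  have t2 : -(2 * |v| * (L * G * P)) ≤ 2 * (η * v) * ((s₀ * x₀ + s₁ * x₁) * d₀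
      + (s₁ * x₀ + s₂ * x₁) * d₁) := by
    refine (abs_le.1 ?_).1
    rw [abs_mul, abs_mul, abs_mul, abs_of_nonneg hη0, abs_two]
    calc 2 * (η * |v|) * |(s₀ * x₀ + s₁ * x₁) * d₀ + (s₁ * x₀ + s₂ * x₁) * d₁|
        ≤ 2 * (1 * |v|) * (L * G * P) := by gcongr
      _ = _ := by ring
  have t3 : -(v ^ 2 * (L * G * (2 * K / r))) ≤ v ^ 2 * ((s₀ * x₀ + s₁ * x₁) * η₀
      + (s₁ * x₀ + s₂ * x₁) * η₁) := by
    rw [← mul_neg]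
    exact mul_le_mul_of_nonneg_left (abs_le.1 b2).1 (sq_nonneg v)
  have t4 : -(ε * (|v| * |g|)) ≤ η * (v * -(ε * g)) := by
    refine (abs_le.1 ?_).1
    rw [abs_mul, abs_mul, abs_neg, abs_mul, abs_of_nonneg hη0, abs_of_pos hε]
    calc η * (|v| * (ε * |g|)) ≤ 1 * (|v| * (ε * |g|)) := by gcongr
      _ = _ := by ring
  have t5 : -(K ^ 2 * (v ^ 2 * (a ^ 2 + b ^ 2) / r ^ 2))
      ≤ v ^ 2 / 2 * (a ^ 2 * η₀₀ + 2 * (a * b) * η₁₀ + b ^ 2 * η₁₁) := by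
    have c1 : |a ^ 2 * η₀₀ + 2 * (a * b) * η₁₀ + b ^ 2 * η₁₁|
        ≤ 2 * (a ^ 2 + b ^ 2) * (K ^ 2 / r ^ 2) := by
      refine (abs_add_three _ _ _).trans ?_
      simp only [abs_mul, abs_pow, sq_abs, abs_two]
      have c2 : 2 * (|a| * |b|) ≤ a ^ 2 + b ^ 2 := by
        nlinarith [sq_nonneg (|a| - |b|), sq_abs a, sq_abs b]
      calc a ^ 2 * |η₀₀| + 2 * (|a| * |b|) * |η₁₀| + b ^ 2 * |η₁₁|
          ≤ a ^ 2 * (K ^ 2 / r ^ 2) + (a ^ 2 + b ^ 2) * (K ^ 2 / r ^ 2)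
            + b ^ 2 * (K ^ 2 / r ^ 2) := by gcongr
        _ = _ := by ring
    calc -(K ^ 2 * (v ^ 2 * (a ^ 2 + b ^ 2) / r ^ 2))
        = v ^ 2 / 2 * -(2 * (a ^ 2 + b ^ 2) * (K ^ 2 / r ^ 2)) := by ring
      _ ≤ _ := mul_le_mul_of_nonneg_left (abs_le.1 c1).1 (by positivity)
  have t6 : η * v ^ 2 * ((s₀ * m₀ + s₁ * m₁) * (s₁ * m₁ + s₂ * m₂)
          - (s₁ * m₀ + s₂ * m₁) * (s₀ * m₁ + s₁ * m₂)) ≤ 0 :=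
    mul_nonpos_of_nonneg_of_nonpos (by positivity) hD
  have t7 : 5 * K ^ 2 * (v ^ 2 * (a ^ 2 + b ^ 2) / r ^ 2)
      ≤ 10 * K ^ 2 * (L ^ 2 / l) * (h * (v ^ 2 / r ^ 2)) := by
    have c1 : a ^ 2 + b ^ 2 ≤ 2 * (L ^ 2 / l) * h := by
      refine hab.trans ?_
      gcongr
      rw [le_div_iff₀ hl, sq]
      gcongr
    calc 5 * K ^ 2 * (v ^ 2 * (a ^ 2 + b ^ 2) / r ^ 2)
        ≤ 5 * K ^ 2 * (v ^ 2 * (2 * (L ^ 2 / l) * h) / r ^ 2) := by gcongr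
      _ = _ := by ring
  have t8 : 2 * |v| * (L * G * P) + v ^ 2 * (L * G * (2 * K / r))
      ≤ 2 * K * L * (G * (|v| * P + v ^ 2 / r)) := by
    have c1 : 1 * (2 * |v| * (L * G * P)) ≤ K * (2 * |v| * (L * G * P)) := by gcongr
    calc _ ≤ K * (2 * |v| * (L * G * P)) + v ^ 2 * (L * G * (2 * K / r)) := by linarith
      _ = _ := by ring
  linarith

lemma pd_affF (c : ℝ) (b : Fin 2 → ℝ) (i : Fin 2) (x : E2) : pd (affF c b) i x = b i := by
  have h : affF c b = fun x : E2 => (c + b 0 * x 0) + b 1 * x 1 := by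
    ext x
    simp [affF, Fin.sum_univ_two, add_assoc]
  have hc (y : E2) : pd (fun _ : E2 => c) i y = 0 := by simp [pd]
  rw [h]
  simp (disch := fun_prop) only [pd_add, pd_coord, hc]
  fin_cases i <;> simp

lemma contDiff_affF (c : ℝ) (b : Fin 2 → ℝ) : ContDiff ℝ (⊤ : ℕ∞) (affF c b) := by
  have h : affF c b = fun x : E2 => (c + b 0 * x 0) + b 1 * x 1 := by
    ext x
    simp [affF, Fin.sum_univ_two, add_assoc]
  rw [h]
  fun_prop

lemma integrableOn_ball {f : E2 → ℝ} (hf : Continuous f) (x : E2) (s : ℝ) :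
    IntegrableOn f (ball x s) :=
  (hf.continuousOn.integrableOn_compact (isCompact_closedBall x s)).mono_set ball_subset_closedBall

lemma setIntegral_mul_le_sqrt {f g : E2 → ℝ} (hf : Continuous f) (hg : Continuous g)
    (hf0 : ∀ x, 0 ≤ f x) (hg0 : ∀ x, 0 ≤ g x) (x : E2) (s : ℝ) :
    ∫ y in ball x s, f y * g y
      ≤ √(∫ y in ball x s, f y ^ 2) * √(∫ y in ball x s, g y ^ 2) := by
  have hm {f : E2 → ℝ} (hf : Continuous f) :
      MemLp f (ENNReal.ofReal 2) (volume.restrict (ball x s)) := by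
    rw [ENNReal.ofReal_ofNat]
    exact (memLp_two_iff_integrable_sq hf.aestronglyMeasurable).2
      (integrableOn_ball (hf.pow 2) x s)
  have h := integral_mul_le_Lp_mul_Lq_of_nonneg (μ := volume.restrict (ball x s))
    Real.HolderConjugate.two_two (.of_forall hf0) (.of_forall hg0) (hm hf) (hm hg)
  simpa [Real.sqrt_eq_rpow] using h

lemma setIntegral_eq_avgOn {x : E2} {s : ℝ} (hs : 0 < s) (f : E2 → ℝ) :
    ∫ y in ball x s, f y = Real.pi * s ^ 2 * avgOn (ball x s) f := by
  have h : (volume (ball x s)).toReal = Real.pi * s ^ 2 := by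
    rw [EuclideanSpace.volume_ball_fin_two]
    simp [hs.le, mul_comm, Real.pi_pos.le]
  have hp := Real.pi_pos
  rw [avgOn, h, mul_inv_cancel_left₀ (by positivity)]

lemma avgOn_congr {V : Set E2} (hV : MeasurableSet V) {f g : E2 → ℝ} (h : EqOn f g V) :
    avgOn V f = avgOn V g := by
  rw [avgOn, avgOn, setIntegral_congr_fun hV h]

lemma avgOn_nonneg {V : Set E2} {f : E2 → ℝ} (h : ∀ x, 0 ≤ f x) : 0 ≤ avgOn V f :=
  mul_nonneg (by positivity) (integral_nonneg h)

lemma divDpH_eq {H w : E2 → ℝ} (hH : ContDiff ℝ (⊤ : ℕ∞) H) (hw : ContDiff ℝ (⊤ : ℕ∞) w) (x : E2) :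
    divDpH H w x = pd (pd H 0) 0 (gradE w x) * pd (pd w 0) 0 x
      + pd (pd H 1) 0 (gradE w x) * pd (pd w 1) 0 x
      + (pd (pd H 1) 0 (gradE w x) * pd (pd w 1) 0 x
        + pd (pd H 1) 1 (gradE w x) * pd (pd w 1) 1 x) := by
  simp only [divDpH, Fin.sum_univ_two]
  rw [pd_comp_gradE_s6 (contDiff_pd hH 0) hw, pd_comp_gradE_s6 (contDiff_pd hH 1) hw, pd_comm hH 0 1,
    pd_comm hw 0 1]

lemma vnorm_nonneg (b : Fin 2 → ℝ) : 0 ≤ vnorm b := Real.sqrt_nonneg _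

lemma sq_sub_le_norm_add_vnorm (p : E2) (b : Fin 2 → ℝ) :
    (p 0 - b 0) ^ 2 + (p 1 - b 1) ^ 2 ≤ (‖p‖ + vnorm b) ^ 2 := by
  set q : E2 := (EuclideanSpace.equiv (Fin 2) ℝ).symm b
  have hq : ‖q‖ = vnorm b := by
    simp [q, vnorm, EuclideanSpace.norm_eq]
  have h := norm_sub_le p q
  rw [hq] at h
  have h2 := pow_le_pow_left₀ (norm_nonneg _) h 2
  rwa [sq_norm_eq] at h2

lemma setIntegral_flatness_le {H w η : E2 → ℝ} (hH : ContDiff ℝ (⊤ : ℕ∞) H) (hS : StrongH H)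
    (hw : ContDiff ℝ (⊤ : ℕ∞) w) {ε r K : ℝ} (hε : 0 < ε) (hr : 0 < r) (hK : 1 ≤ K) {xb : E2}
    (hpde : ∀ x ∈ ball xb r, aronsson H w x + ε * divDpH H w x = 0)
    (hη : ContDiff ℝ (⊤ : ℕ∞) η) (hc : HasCompactSupport η)
    (h0 : ∀ x, 0 ≤ η x) (h1 : ∀ x, η x ≤ 1) (hone : ∀ x ∈ ball xb (r / 2), η x = 1)
    (hz : ∀ x ∉ ball xb (3 * r / 4), η x = 0)
    (hz1 : ∀ i, ∀ x ∉ ball xb (3 * r / 4), pd η i x = 0)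
    (hz2 : ∀ i j, ∀ x ∉ ball xb (3 * r / 4), pd (pd η i) j x = 0)
    (hb1 : ∀ i x, pd η i x ^ 2 ≤ K ^ 2 * η x / r ^ 2)
    (hb2 : ∀ i j x, |pd (pd η i) j x| ≤ K ^ 2 / r ^ 2) (c : ℝ) (b : Fin 2 → ℝ) :
    ∫ x in ball xb (r / 2), (∑ i, pd H i (gradE w x) * (gradV w x i - b i)) ^ 2
      ≤ 2 * (ε * (∫ x in ball xb (3 * r / 4), |w x - affF c b x| * |divDpH H w x|)
        + 2 * K * LamInf H * (∫ x in ball xb (3 * r / 4), ‖gradE (fun y => H (gradE w y)) x‖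
          * (|w x - affF c b x| * (‖gradE w x‖ + vnorm b) + (w x - affF c b x) ^ 2 / r))
        + 10 * K ^ 2 * (LamInf H ^ 2 / lamInf H) * (∫ x in ball xb (3 * r / 4), H (gradE w x)
          * ((w x - affF c b x) ^ 2 / r ^ 2))) := by
  obtain ⟨hl, hlL, hlow, hup, hgrad⟩ := hS.bounds hH
  have hgE := contDiff_gradE hw
  have hF := contDiff_affF c b
  set v : E2 → ℝ := fun x => w x - affF c b x with hv
  have hvs : ContDiff ℝ (⊤ : ℕ∞) v := hw.sub hF
  have hv1 (i : Fin 2) : pd v i = fun x => pd w i x - b i := by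
    ext x
    rw [hv, pd_sub (differentiable_of_smooth hw) (differentiable_of_smooth hF), pd_affF]
  have hv2 (i j : Fin 2) (x : E2) : pd (pd v i) j x = pd (pd w i) j x := by
    rw [hv1, pd_sub (differentiable_of_smooth (contDiff_pd hw i)) (differentiable_const _)]
    simp [pd]
  have hA (i : Fin 2) : ContDiff ℝ (⊤ : ℕ∞) (fun x => pd H i (gradE w x)) :=
    (contDiff_pd hH i).comp hgE
  have hHw : ContDiff ℝ (⊤ : ℕ∞) (fun x => H (gradE w x)) := hH.comp hgE
  have hdiv : Continuous (divDpH H w) := by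
    have e : divDpH H w = fun x => pd (fun y => pd H 0 (gradE w y)) 0 x
        + pd (fun y => pd H 1 (gradE w y)) 1 x := by
      ext x
      simp [divDpH, Fin.sum_univ_two]
    rw [e]
    exact (contDiff_pd (hA 0) 0).continuous.add (contDiff_pd (hA 1) 1).continuous
  have hident := integral_flatness_identity (hA 0) (hA 1) hvs hη hc
  set E : E2 → ℝ := _ with hE
  change ∫ x, E x = 0 at hident
  have hEz (x : E2) (hx : x ∉ ball xb (3 * r / 4)) : E x = 0 := by
    simp [hE, hz x hx, hz1 _ x hx, hz2 _ _ x hx]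
  rw [← setIntegral_eq_integral_of_forall_compl_eq_zero hEz] at hident
  have hEc : Continuous E := by
    have k1 (i : Fin 2) := (hA i).continuous
    have k2 (i j : Fin 2) := (contDiff_pd (hA i) j).continuous
    have k3 (i : Fin 2) := (contDiff_pd hvs i).continuous
    have k4 (i j : Fin 2) := (contDiff_pd (contDiff_pd hvs i) j).continuous
    have k5 (i : Fin 2) := (contDiff_pd hη i).continuous
    have k6 (i j : Fin 2) := (contDiff_pd (contDiff_pd hη i) j).continuous
    have k7 := hvs.continuous
    have k8 := hη.continuous
    rw [hE]
    have := k1 0; have := k1 1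
    have := k2 0 0; have := k2 0 1; have := k2 1 0; have := k2 1 1
    have := k3 0; have := k3 1
    have := k4 0 0; have := k4 1 0; have := k4 1 1
    have := k5 0; have := k5 1
    have := k6 0 0; have := k6 1 0; have := k6 1 1
    fun_prop
  set R₁ : E2 → ℝ := fun x => |v x| * |divDpH H w x| with hR₁
  set R₂ : E2 → ℝ := fun x => ‖gradE (fun y => H (gradE w y)) x‖
    * (|v x| * (‖gradE w x‖ + vnorm b) + v x ^ 2 / r) with hR₂
  set R₃ : E2 → ℝ := fun x => H (gradE w x) * (v x ^ 2 / r ^ 2) with hR₃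
  set T : E2 → ℝ := fun x => (∑ i, pd H i (gradE w x) * (gradV w x i - b i)) ^ 2 with hT
  have hTe (x : E2) : T x = (pd H 0 (gradE w x) * pd v 0 x + pd H 1 (gradE w x) * pd v 1 x) ^ 2 := by
    simp only [hT, Fin.sum_univ_two, hv1]
    rfl
  have hTc : Continuous T := by
    rw [funext hTe]
    exact (((hA 0).continuous.mul (contDiff_pd hvs 0).continuous).add
      ((hA 1).continuous.mul (contDiff_pd hvs 1).continuous)).pow 2
  have hT0 (x : E2) : 0 ≤ T x := sq_nonneg _
  have hR₁c : Continuous R₁ := hvs.continuous.abs.mul hdiv.abs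
  have hR₂c : Continuous R₂ := (contDiff_gradE hHw).continuous.norm.mul
    ((hvs.continuous.abs.mul (hgE.continuous.norm.add continuous_const)).add
      ((hvs.continuous.pow 2).div_const r))
  have hR₃c : Continuous R₃ := hHw.continuous.mul ((hvs.continuous.pow 2).div_const _)
  have hpt : ∀ x ∈ ball xb (3 * r / 4), η x * T x / 2 - (ε * R₁ x + 2 * K * LamInf H * R₂ x
      + 10 * K ^ 2 * (LamInf H ^ 2 / lamInf H) * R₃ x) ≤ E x := by
    intro x hx
    have hp := hpde x (ball_subset_ball (by linarith) hx)
    have hc0 (i j : Fin 2) := pd_comp_gradE_s6 (contDiff_pd hH i) hw j x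
    have hd := divDpH_eq hH hw x
    have hh (j : Fin 2) := pd_comp_gradE_s6 hH hw j x
    have hsq := sq_norm_gradE (fun y => H (gradE w y)) x
    rw [hh, hh, pd_comm hw 0 1] at hsq
    simp only [aronsson, Fin.sum_univ_two, pd2, pd_comm hw 0 1] at hp
    rw [hTe]
    simp only [hE, hc0, hv2, pd_comm hH 0 1, pd_comm hw 0 1]
    refine flatness_integrand_lower hr hK hl hlL hε (h0 x) (h1 x) (norm_nonneg _)
      (add_nonneg (norm_nonneg _) (vnorm_nonneg b)) (hS.2.1 _) (hlow _) (hup _) (hgrad _) hd ?_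
      hsq.symm ?_ (hb1 0 x) (hb1 1 x) (hb2 0 0 x) (hb2 1 0 x) (hb2 1 1 x)
    · rw [← hp]
      ring
    · simp only [hv1]
      exact sq_sub_le_norm_add_vnorm (gradE w x) b
  have hi {f : E2 → ℝ} (hf : Continuous f) := integrableOn_ball hf xb (3 * r / 4)
  have hηT : Continuous fun x => η x * T x / 2 := (hη.continuous.mul hTc).div_const 2
  have hmono := setIntegral_mono_on (((hi hηT)).sub ((((hi hR₁c).const_mul ε).add
    ((hi hR₂c).const_mul (2 * K * LamInf H))).add
    ((hi hR₃c).const_mul (10 * K ^ 2 * (LamInf H ^ 2 / lamInf H))))) (hi hEc)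
    measurableSet_ball hpt
  rw [hident, integral_sub' (hi hηT) ((((hi hR₁c).const_mul ε).add
    ((hi hR₂c).const_mul (2 * K * LamInf H))).add
    ((hi hR₃c).const_mul (10 * K ^ 2 * (LamInf H ^ 2 / lamInf H)))),
    integral_add' (((hi hR₁c).const_mul ε).add ((hi hR₂c).const_mul (2 * K * LamInf H)))
    ((hi hR₃c).const_mul _), integral_add' ((hi hR₁c).const_mul ε) ((hi hR₂c).const_mul _),
    integral_const_mul, integral_const_mul, integral_const_mul, integral_div] at hmono
  have hhalf : ∫ x in ball xb (r / 2), T x ≤ ∫ x in ball xb (3 * r / 4), η x * T x := by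
    rw [setIntegral_congr_fun (g := fun x => η x * T x) measurableSet_ball
      fun x hx => by simp [hone x hx]]
    refine setIntegral_mono_set (hi (hη.continuous.mul hTc))
      (.of_forall fun x => mul_nonneg (h0 x) (hT0 x)) ?_
    exact (ball_subset_ball (by linarith)).eventuallyLE
  linarith

lemma setIntegral_le_avgOn {x : E2} {s r k : ℝ} (hs : 0 < s) (hk : Real.pi * s ^ 2 ≤ k * r ^ 2)
    {f : E2 → ℝ} (hf : ∀ x, 0 ≤ f x) :
    ∫ y in ball x s, f y ≤ k * r ^ 2 * avgOn (ball x s) f := by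
  rw [setIntegral_eq_avgOn hs]
  exact mul_le_mul_of_nonneg_right hk (avgOn_nonneg hf)

lemma sqrt_le_mul_sqrt {X Y k : ℝ} (hk : 0 ≤ k) (h : X ≤ k ^ 2 * Y) : √X ≤ k * √Y := by
  rw [← Real.sqrt_sq hk, ← Real.sqrt_mul (sq_nonneg k)]
  exact Real.sqrt_le_sqrt h

/-- The flatness estimate for globally defined smooth `w`. -/
lemma exists_flatness_const :
    ∃ C : ℝ, 0 < C ∧ ∀ H : E2 → ℝ, ContDiff ℝ (⊤ : ℕ∞) H → StrongH H →
    ∀ ε : ℝ, 0 < ε → ∀ w : E2 → ℝ, ContDiff ℝ (⊤ : ℕ∞) w → ∀ (xb : E2) (r : ℝ), 0 < r →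
      (∀ x ∈ ball xb r, aronsson H w x + ε * divDpH H w x = 0) →
    ∀ (c : ℝ) (b : Fin 2 → ℝ),
      avgOn (ball xb (r / 2))
          (fun x => (∑ i, pd H i (gradE w x) * (gradV w x i - b i)) ^ 2)
      ≤ C * LamInf H *
            Real.sqrt (∫ x in ball xb (3 * r / 4),
              ‖gradE (fun y => H (gradE w y)) x‖ ^ 2) *
            Real.sqrt (avgOn (ball xb r) (fun x =>
              (‖gradE w x‖ + vnorm b) ^ 2 * (w x - affF c b x) ^ 2 / r ^ 2
                + (w x - affF c b x) ^ 4 / r ^ 4))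
        + C * (LamInf H ^ 2 / lamInf H) *
            Real.sqrt (avgOn (ball xb (3 * r / 4)) (fun x => H (gradE w x) ^ 2)) *
            Real.sqrt (avgOn (ball xb (3 * r / 4)) (fun x =>
              (w x - affF c b x) ^ 4 / r ^ 4))
        + C * ε *
            Real.sqrt (∫ x in ball xb (3 * r / 4), (divDpH H w x) ^ 2) *
            Real.sqrt (avgOn (ball xb (3 * r / 4)) (fun x =>
              (w x - affF c b x) ^ 2 / r ^ 2)) := by
  obtain ⟨K₀, hK₀, hcut⟩ := exists_cutoff
  obtain ⟨K, hK1, hKK⟩ : ∃ K : ℝ, 1 ≤ K ∧ K₀ ≤ K ^ 2 :=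
    ⟨1 + K₀, by linarith, by nlinarith⟩
  refine ⟨60 * K ^ 2, by positivity, fun H hH hS ε hε w hw xb r hr hpde c b => ?_⟩
  obtain ⟨η, hη, hc, h0, h1, hone, hz, hz1, hz2, hb1, hb2⟩ := hcut xb r hr
  have hmain := setIntegral_flatness_le hH hS hw hε hr hK1 hpde hη hc h0 h1 hone hz hz1 hz2
    (fun i x => (hb1 i x).trans (by have := h0 x; gcongr))
    (fun i j x => (hb2 i j x).trans (by gcongr)) c b
  obtain ⟨hl, hlL, -⟩ := hS.bounds hH
  have hL : 0 < LamInf H := hl.trans_le hlL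
  have hgE := contDiff_gradE hw
  have hHw : ContDiff ℝ (⊤ : ℕ∞) (fun x => H (gradE w x)) := hH.comp hgE
  have hvc : Continuous fun x => w x - affF c b x := hw.continuous.sub (contDiff_affF c b).continuous
  have hdiv : Continuous (divDpH H w) := by
    rw [funext (divDpH_eq hH hw)]
    have k1 (i j : Fin 2) : Continuous fun x => pd (pd H i) j (gradE w x) :=
      (contDiff_pd (contDiff_pd hH i) j).continuous.comp hgE.continuous
    have k2 (i j : Fin 2) := (contDiff_pd (contDiff_pd hw i) j).continuous
    exact (((k1 0 0).mul (k2 0 0)).add ((k1 1 0).mul (k2 1 0))).add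
      (((k1 1 0).mul (k2 1 0)).add ((k1 1 1).mul (k2 1 1)))
  have hGc := (contDiff_gradE hHw).continuous.norm
  have hπ3 := Real.pi_gt_three
  have hπ4 : Real.pi < 3.2 := lt_trans Real.pi_lt_d2 (by norm_num)
  have hr34 : 0 < 3 * r / 4 := by linarith
  have hr2 : 0 < r ^ 2 := by positivity
  have hvol : Real.pi * (3 * r / 4) ^ 2 ≤ 2 * r ^ 2 := by nlinarith
  have hvol1 : Real.pi * r ^ 2 ≤ 4 * r ^ 2 := by nlinarith
  set v : E2 → ℝ := fun x => w x - affF c b x with hv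
  set G : E2 → ℝ := fun x => ‖gradE (fun y => H (gradE w y)) x‖ with hG
  set P : E2 → ℝ := fun x => ‖gradE w x‖ + vnorm b with hP
  have hPc : Continuous P := hgE.continuous.norm.add continuous_const
  have hP0 (x : E2) : 0 ≤ P x := add_nonneg (norm_nonneg _) (vnorm_nonneg b)
  set A₁ := avgOn (ball xb r) fun x => P x ^ 2 * v x ^ 2 / r ^ 2 + v x ^ 4 / r ^ 4
  set A₂ := avgOn (ball xb (3 * r / 4)) fun x => H (gradE w x) ^ 2
  set A₃ := avgOn (ball xb (3 * r / 4)) fun x => v x ^ 4 / r ^ 4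
  set A₄ := avgOn (ball xb (3 * r / 4)) fun x => v x ^ 2 / r ^ 2
  set D := ∫ x in ball xb (3 * r / 4), divDpH H w x ^ 2
  set N := ∫ x in ball xb (3 * r / 4), G x ^ 2
  have e1 : ∫ x in ball xb (3 * r / 4), |v x| * |divDpH H w x| ≤ 2 * r ^ 2 * (√D * √A₄) := by
    have h := setIntegral_mul_le_sqrt hvc.abs hdiv.abs (fun _ => abs_nonneg _)
      (fun _ => abs_nonneg _) xb (3 * r / 4)
    simp only [sq_abs] at h
    have h2 : √(∫ x in ball xb (3 * r / 4), v x ^ 2) ≤ 2 * r ^ 2 * √A₄ := by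
      refine sqrt_le_mul_sqrt (by positivity) ?_
      have h3 : ∫ x in ball xb (3 * r / 4), v x ^ 2
          = r ^ 2 * ∫ x in ball xb (3 * r / 4), v x ^ 2 / r ^ 2 := by
        rw [integral_div, mul_div_cancel₀ _ hr2.ne']
      rw [h3]
      calc r ^ 2 * ∫ x in ball xb (3 * r / 4), v x ^ 2 / r ^ 2 ≤ r ^ 2 * (4 * r ^ 2 * A₄) := by
            gcongr
            exact setIntegral_le_avgOn hr34 (hvol.trans (by linarith)) fun x => by positivity
        _ = (2 * r ^ 2) ^ 2 * A₄ := by ring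
    calc _ ≤ (2 * r ^ 2 * √A₄) * √D := h.trans (by gcongr)
      _ = _ := by ring
  have e2 : ∫ x in ball xb (3 * r / 4), G x * (|v x| * P x + v x ^ 2 / r)
      ≤ 3 * r ^ 2 * (√N * √A₁) := by
    have h := setIntegral_mul_le_sqrt (g := fun x => |v x| * P x + v x ^ 2 / r) hGc
      ((hvc.abs.mul hPc).add ((hvc.pow 2).div_const r)) (fun _ => norm_nonneg _)
      (fun x => by have := hP0 x; positivity) xb (3 * r / 4)
    have h2 : √(∫ x in ball xb (3 * r / 4), (|v x| * P x + v x ^ 2 / r) ^ 2)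
        ≤ 3 * r ^ 2 * √A₁ := by
      refine sqrt_le_mul_sqrt (by positivity) ?_
      have hQc : Continuous fun x => P x ^ 2 * v x ^ 2 / r ^ 2 + v x ^ 4 / r ^ 4 :=
        (((hPc.pow 2).mul (hvc.pow 2)).div_const _).add ((hvc.pow 4).div_const _)
      have hSc : Continuous fun x => (|v x| * P x + v x ^ 2 / r) ^ 2 :=
        ((hvc.abs.mul hPc).add ((hvc.pow 2).div_const r)).pow 2
      calc ∫ x in ball xb (3 * r / 4), (|v x| * P x + v x ^ 2 / r) ^ 2
          ≤ ∫ x in ball xb r, (|v x| * P x + v x ^ 2 / r) ^ 2 :=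
            setIntegral_mono_set (integrableOn_ball hSc xb r) (.of_forall fun x => sq_nonneg _)
              (ball_subset_ball (by linarith)).eventuallyLE
        _ ≤ ∫ x in ball xb r, 2 * r ^ 2 * (P x ^ 2 * v x ^ 2 / r ^ 2 + v x ^ 4 / r ^ 4) := by
            refine setIntegral_mono (integrableOn_ball hSc xb r)
              (integrableOn_ball (continuous_const.mul hQc) xb r) fun x => ?_
            have hq : 2 * r ^ 2 * (P x ^ 2 * v x ^ 2 / r ^ 2 + v x ^ 4 / r ^ 4)
                = 2 * (|v x| * P x) ^ 2 + 2 * (v x ^ 2 / r) ^ 2 := by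
              rw [mul_pow, sq_abs]
              field_simp
            simp only [hq]
            nlinarith [sq_nonneg (|v x| * P x - v x ^ 2 / r)]
        _ = 2 * r ^ 2 * ∫ x in ball xb r, (P x ^ 2 * v x ^ 2 / r ^ 2 + v x ^ 4 / r ^ 4) :=
            integral_const_mul _ _
        _ ≤ 2 * r ^ 2 * (4 * r ^ 2 * A₁) := by
            gcongr
            exact setIntegral_le_avgOn hr hvol1 fun x => by positivity
        _ ≤ (3 * r ^ 2) ^ 2 * A₁ := by
            have : 0 ≤ r ^ 4 * A₁ :=
              mul_nonneg (by positivity) (avgOn_nonneg fun x => by positivity)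
            nlinarith
    calc _ ≤ √N * (3 * r ^ 2 * √A₁) := h.trans (by gcongr)
      _ = _ := by ring
  have e3 : ∫ x in ball xb (3 * r / 4), H (gradE w x) * (v x ^ 2 / r ^ 2)
      ≤ 2 * r ^ 2 * (√A₂ * √A₃) := by
    have h := setIntegral_mul_le_sqrt (g := fun x => v x ^ 2 / r ^ 2) hHw.continuous
      ((hvc.pow 2).div_const _) (fun _ => hS.2.1 _) (fun _ => by positivity) xb (3 * r / 4)
    have hq (x : E2) : (v x ^ 2 / r ^ 2) ^ 2 = v x ^ 4 / r ^ 4 := by ring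
    simp only [hq] at h
    have hsq : (√(2 * r ^ 2)) ^ 2 = 2 * r ^ 2 := Real.sq_sqrt (by positivity)
    have h2 : √(∫ x in ball xb (3 * r / 4), H (gradE w x) ^ 2) ≤ √(2 * r ^ 2) * √A₂ := by
      refine sqrt_le_mul_sqrt (by positivity) ?_
      rw [hsq]
      exact setIntegral_le_avgOn hr34 hvol fun x => by positivity
    have h3 : √(∫ x in ball xb (3 * r / 4), v x ^ 4 / r ^ 4) ≤ √(2 * r ^ 2) * √A₃ := by
      refine sqrt_le_mul_sqrt (by positivity) ?_
      rw [hsq]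
      exact setIntegral_le_avgOn hr34 hvol fun x => by positivity
    calc _ ≤ (√(2 * r ^ 2) * √A₂) * (√(2 * r ^ 2) * √A₃) := h.trans (by gcongr)
      _ = (√(2 * r ^ 2)) ^ 2 * (√A₂ * √A₃) := by ring
      _ = _ := by rw [hsq]
  rw [setIntegral_eq_avgOn (by linarith)] at hmain
  set T := avgOn (ball xb (r / 2))
    fun x => (∑ i, pd H i (gradE w x) * (gradV w x i - b i)) ^ 2 with hT
  have hT0 : 0 ≤ T := avgOn_nonneg fun x => sq_nonneg _
  have hm2 : 3 / 4 * r ^ 2 * T ≤ r ^ 2 * (2 * (ε * (2 * (√D * √A₄))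
      + 2 * K * LamInf H * (3 * (√N * √A₁))
      + 10 * K ^ 2 * (LamInf H ^ 2 / lamInf H) * (2 * (√A₂ * √A₃)))) := by
    calc 3 / 4 * r ^ 2 * T ≤ Real.pi * (r / 2) ^ 2 * T := by
          refine mul_le_mul_of_nonneg_right ?_ hT0
          nlinarith
      _ ≤ _ := hmain
      _ ≤ 2 * (ε * (2 * r ^ 2 * (√D * √A₄)) + 2 * K * LamInf H * (3 * r ^ 2 * (√N * √A₁))
          + 10 * K ^ 2 * (LamInf H ^ 2 / lamInf H) * (2 * r ^ 2 * (√A₂ * √A₃))) := by gcongr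
      _ = _ := by ring
  have hm3 : 3 / 4 * T ≤ 2 * (ε * (2 * (√D * √A₄)) + 2 * K * LamInf H * (3 * (√N * √A₁))
      + 10 * K ^ 2 * (LamInf H ^ 2 / lamInf H) * (2 * (√A₂ * √A₃))) := by
    refine le_of_mul_le_mul_left ?_ hr2
    linarith
  have f1 : 0 ≤ ε * (√D * √A₄) := by positivity
  have f2 : 0 ≤ LamInf H * (√N * √A₁) := by positivity
  have f3 : 0 ≤ K ^ 2 * (LamInf H ^ 2 / lamInf H * (√A₂ * √A₃)) := by positivity
  have hK2 : 1 ≤ K ^ 2 := one_le_pow₀ hK1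
  have hKK2 : K ≤ K ^ 2 := le_self_pow₀ hK1 two_ne_zero
  have g1 : 1 * (ε * (√D * √A₄)) ≤ K ^ 2 * (ε * (√D * √A₄)) := by gcongr
  have g2 : K * (LamInf H * (√N * √A₁)) ≤ K ^ 2 * (LamInf H * (√N * √A₁)) := by gcongr
  have g3 : 0 ≤ K ^ 2 * (LamInf H * (√N * √A₁)) := by positivity
  linarith

/-- A smooth function on an open set agrees near a compact subset with a globally smooth one. -/
lemma exists_contDiff_eqOn {U K : Set E2} (hU : IsOpen U) (hK : IsCompact K) (hKU : K ⊆ U)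
    {w : E2 → ℝ} (hw : ContDiffOn ℝ (⊤ : ℕ∞) w U) :
    ∃ W : E2 → ℝ, ContDiff ℝ (⊤ : ℕ∞) W ∧ EqOn w W K := by
  obtain ⟨V, hV, hKV, hVU⟩ := normal_exists_closure_subset hK.isClosed hU hKU
  obtain ⟨f, hf1, hf0, -⟩ := exists_contMDiffMap_one_nhds_of_subset_interior
    (modelWithCornersSelf ℝ E2) (n := (⊤ : ℕ∞)) hK.isClosed
    (hKV.trans (hV.subset_interior_iff.2 subset_rfl))
  have hfs : ContDiff ℝ (⊤ : ℕ∞) f := f.contMDiff.contDiff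
  refine ⟨fun x => f x * w x, ?_, fun x hx => ?_⟩
  · rw [contDiff_iff_contDiffAt]
    intro x
    by_cases hx : x ∈ U
    · exact hfs.contDiffAt.mul (hw.contDiffAt (hU.mem_nhds hx))
    · have hx' : x ∈ (closure V)ᶜ := fun h => hx (hVU h)
      refine (contDiffAt_const (c := (0 : ℝ))).congr_of_eventuallyEq ?_
      filter_upwards [isClosed_closure.isOpen_compl.mem_nhds hx'] with y hy
      rw [hf0 y fun h => hy (subset_closure h), zero_mul]
  · have := hf1.self_of_nhdsSet x hx
    simp [this]

/-- integral flatness estimate for `u^ε`, Lemma 2.8. -/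
theorem statement6 :
    ∃ C : ℝ, 0 < C ∧
    ∀ H : E2 → ℝ, ContDiff ℝ (⊤ : ℕ∞) H → StrongH H →
    ∀ U : Set E2, IsOpen U → IsConnected U →
    ∀ ε : ℝ, ε ∈ Ioc (0 : ℝ) 1 →
    ∀ w : E2 → ℝ, ContDiffOn ℝ (⊤ : ℕ∞) w U →
      (∀ x ∈ U, aronsson H w x + ε * divDpH H w x = 0) →
    ∀ (xb : E2) (r : ℝ), 0 < r → closure (ball xb r) ⊆ U →
    ∀ (c : ℝ) (b : Fin 2 → ℝ),
      avgOn (ball xb (r / 2))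
          (fun x => (∑ i, pd H i (gradE w x) * (gradV w x i - b i)) ^ 2)
      ≤ C * LamInf H *
            Real.sqrt (∫ x in ball xb (3 * r / 4),
              ‖gradE (fun y => H (gradE w y)) x‖ ^ 2) *
            Real.sqrt (avgOn (ball xb r) (fun x =>
              (‖gradE w x‖ + vnorm b) ^ 2 * (w x - affF c b x) ^ 2 / r ^ 2
                + (w x - affF c b x) ^ 4 / r ^ 4))
        + C * (LamInf H ^ 2 / lamInf H) *
            Real.sqrt (avgOn (ball xb (3 * r / 4)) (fun x => H (gradE w x) ^ 2)) *
            Real.sqrt (avgOn (ball xb (3 * r / 4)) (fun x =>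
              (w x - affF c b x) ^ 4 / r ^ 4))
        + C * ε *
            Real.sqrt (∫ x in ball xb (3 * r / 4), (divDpH H w x) ^ 2) *
            Real.sqrt (avgOn (ball xb (3 * r / 4)) (fun x =>
              (w x - affF c b x) ^ 2 / r ^ 2)) := by
  obtain ⟨C, hC, h⟩ := exists_flatness_const
  refine ⟨C, hC, fun H hH hS U hU _ ε hε w hw hpde xb r hr hBU c b => ?_⟩
  obtain ⟨W, hW, hwW⟩ := exists_contDiff_eqOn hU
    (isCompact_closedBall xb r) ((closure_ball xb hr.ne').symm ▸ hBU) hw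
  have hB : EqOn w W (ball xb r) := hwW.mono ball_subset_closedBall
  have h1 (i : Fin 2) := pd_eqOn isOpen_ball hB i
  have h2 (i j : Fin 2) : EqOn (pd2 w i j) (pd2 W i j) (ball xb r) :=
    pd_eqOn isOpen_ball (h1 j) i
  have hgV : EqOn (gradV w) (gradV W) (ball xb r) := fun x hx => funext fun i => h1 i hx
  have hgE : EqOn (gradE w) (gradE W) (ball xb r) := fun x hx => by rw [gradE, gradE, hgV hx]
  have hcomp (g : E2 → ℝ) : EqOn (fun x => g (gradE w x)) (fun x => g (gradE W x)) (ball xb r) :=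
    fun x hx => congrArg g (hgE hx)
  have hdiv : EqOn (divDpH H w) (divDpH H W) (ball xb r) := fun x hx =>
    Finset.sum_congr rfl fun i _ => pd_eqOn isOpen_ball (hcomp (pd H i)) i hx
  have har : EqOn (aronsson H w) (aronsson H W) (ball xb r) := fun x hx => by
    simp only [aronsson, hgE hx, h2 _ _ hx]
  have hgH : EqOn (gradE fun y => H (gradE w y)) (gradE fun y => H (gradE W y)) (ball xb r) :=
    fun x hx => by
      unfold gradE gradV
      exact congrArg _ (funext fun i => pd_eqOn isOpen_ball (hcomp H) i hx)
  have hmain := h H hH hS ε hε.1 W hW xb r hr (fun x hx => by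
    rw [← har hx, ← hdiv hx]
    exact hpde x (hBU (subset_closure hx))) c b
  have hs2 : ball xb (r / 2) ⊆ ball xb r := ball_subset_ball (by linarith)
  have hs3 : ball xb (3 * r / 4) ⊆ ball xb r := ball_subset_ball (by linarith)
  convert hmain using 1
  · exact avgOn_congr measurableSet_ball fun x hx => by simp only [hgE (hs2 hx), hgV (hs2 hx)]
  · congr 1
    · congr 1
      · congr 2
        · congr 1
          exact setIntegral_congr_fun measurableSet_ball fun x hx => by simp only [hgH (hs3 hx)]
        · exact avgOn_congr measurableSet_ball fun x hx => by simp only [hgE hx, hB hx]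
      · congr 2
        · congr 1
          exact avgOn_congr measurableSet_ball fun x hx => by simp only [hgE (hs3 hx)]
        · exact avgOn_congr measurableSet_ball fun x hx => by simp only [hB (hs3 hx)]
    · congr 2
      · congr 1
        exact setIntegral_congr_fun measurableSet_ball fun x hx => by simp only [hdiv (hs3 hx)]
      · exact avgOn_congr measurableSet_ball fun x hx => by simp only [hB (hs3 hx)]

end
end
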